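/- Let n ≥ 1, k ≥ 0, α ∈ (0,1), μ ∈ (0,1), and let J : ℝ^{2n} → End(ℝ^{2n}) be of class C^{k,α} (all derivatives up to order k bounded and the k-th derivative α-Hölder) with J(x) ∘ J(x) = −id for all x. Then there exist constants δ > 0 and C > 0, depending only on n, k, α, μ and J, such that every continuous map u : D̄ → ℝ^{2n} which is differentiable on the open unit disk D with ∂u/∂x + J(u) ∂u/∂y = 0 and which satisfies diam(u(D)) < δ is (k+1)-times continuously differentiable on μD̄ with α-Hölder (k+1)-st derivative, and the sum over 1 ≤ j ≤ k+1 of the sup norms of the j-th derivatives of u on μD̄, plus the α-Hölder constant of the (k+1)-st derivative of u on μD̄, is at most C · diam(u(D)). (Local chart version of the interior Gromov–Schwarz estimate, Theorem 2.2.) -/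

import Mathlib

open MeasureTheory

/-- The unit vector of angle `θ`. -/
noncomputable def unitDir (θ : ℝ) : ℂ := (Real.cos θ : ℂ) + Real.sin θ * Complex.I

theorem norm_unitDir (θ : ℝ) : ‖unitDir θ‖ = 1 := by
  have h : unitDir θ = Complex.exp (θ * Complex.I) := by
    rw [unitDir, Complex.exp_mul_I]; push_cast; rfl
  rw [h, Complex.norm_exp_ofReal_mul_I]

theorem hasDerivAt_unitDir (θ : ℝ) : HasDerivAt unitDir (Complex.I * unitDir θ) θ := by
  have h1 := (Real.hasDerivAt_cos θ).ofReal_comp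
  have h2 := ((Real.hasDerivAt_sin θ).ofReal_comp).mul_const Complex.I
  refine (h1.add h2).congr_deriv ?_
  simp only [unitDir]
  push_cast
  linear_combination (-(Complex.sin θ)) * Complex.I_sq

theorem continuous_unitDir : Continuous unitDir :=
  continuous_iff_continuousAt.2 fun θ => (hasDerivAt_unitDir θ).continuousAt

theorem fderiv_apply_unit_combination (D : ℂ →L[ℝ] ℂ) (r θ : ℝ) (hr : r ≠ 0) :
    (r : ℂ) * ((D 1 + Complex.I * D Complex.I) / (r * unitDir θ)) =
      D (unitDir θ) + Complex.I * D (Complex.I * unitDir θ) := by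
  have hr' : (r : ℂ) ≠ 0 := by exact_mod_cast hr
  have he : unitDir θ ≠ 0 := by
    intro h; have := norm_unitDir θ; rw [h] at this; simp at this
  have h1 : D (unitDir θ) = Real.cos θ * D 1 + Real.sin θ * D Complex.I := by
    have : unitDir θ = Real.cos θ • (1 : ℂ) + Real.sin θ • Complex.I := by
      simp [unitDir]
    rw [this, map_add, map_smul, map_smul]; simp
  have h2 : D (Complex.I * unitDir θ) = - Real.sin θ * D 1 + Real.cos θ * D Complex.I := by
    have : Complex.I * unitDir θ = (-Real.sin θ) • (1 : ℂ) + Real.cos θ • Complex.I := by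
      simp only [unitDir, Complex.real_smul]; push_cast
      linear_combination (Complex.sin θ) * Complex.I_sq
    rw [this, map_add, map_smul, map_smul]; simp
  rw [h1, h2]
  field_simp
  have hcs : (Real.cos θ : ℂ) ^ 2 + (Real.sin θ : ℂ) ^ 2 = 1 := by
    exact_mod_cast Real.cos_sq_add_sin_sq θ
  simp only [unitDir]
  linear_combination (-(D 1 + Complex.I * D Complex.I)) * hcs +
    (Real.sin θ ^ 2 * D 1 - Real.cos θ * Real.sin θ * D Complex.I) * Complex.I_sq

theorem fderiv_eq_zero_of_eq_zero_outside {ψ : ℂ → ℂ} {R : ℝ}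
    (hR : ∀ z, R ≤ ‖z‖ → ψ z = 0) (z : ℂ) (hz : R < ‖z‖) : fderiv ℝ ψ z = 0 := by
  have : ψ =ᶠ[nhds z] fun _ => 0 := by
    filter_upwards [continuous_norm.continuousAt.eventually (lt_mem_nhds hz)] with w hw
    exact hR w hw.le
  rw [this.fderiv_eq]; simp

theorem integral_dbar_div_self {ψ : ℂ → ℂ} (hψ : Differentiable ℝ ψ) {L R : ℝ}
    (hL : ∀ z, ‖fderiv ℝ ψ z‖ ≤ L) (hR : ∀ z, R ≤ ‖z‖ → ψ z = 0) :
    ∫ ζ, (fderiv ℝ ψ ζ 1 + Complex.I * fderiv ℝ ψ ζ Complex.I) / ζ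
      = -(2 * Real.pi) * ψ 0 := by
  have hD0 := fderiv_eq_zero_of_eq_zero_outside hR
  have hm : Measurable (fderiv ℝ ψ) := measurable_fderiv ℝ ψ
  set A : ℝ × ℝ → ℂ := fun p => fderiv ℝ ψ (p.1 * unitDir p.2) (unitDir p.2) with hA
  set B : ℝ × ℝ → ℂ := fun p => fderiv ℝ ψ (p.1 * unitDir p.2) (Complex.I * unitDir p.2) with hB
  have hpt : Continuous fun p : ℝ × ℝ => (p.1 : ℂ) * unitDir p.2 := by
    have := continuous_unitDir
    fun_prop
  have hmA : Measurable A := by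
    have h2 : Measurable fun p : ℝ × ℝ => fderiv ℝ ψ (p.1 * unitDir p.2) := hm.comp hpt.measurable
    have h3 : Measurable fun p : ℝ × ℝ => unitDir p.2 :=
      (continuous_unitDir.comp continuous_snd).measurable
    exact (isBoundedBilinearMap_apply (𝕜 := ℝ) (E := ℂ) (F := ℂ)).continuous.measurable.comp
      (h2.prodMk h3)
  have hmB : Measurable B := by
    have h2 : Measurable fun p : ℝ × ℝ => fderiv ℝ ψ (p.1 * unitDir p.2) := hm.comp hpt.measurable
    have h3 : Measurable fun p : ℝ × ℝ => Complex.I * unitDir p.2 :=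
      (continuous_const.mul (continuous_unitDir.comp continuous_snd)).measurable
    exact (isBoundedBilinearMap_apply (𝕜 := ℝ) (E := ℂ) (F := ℂ)).continuous.measurable.comp
      (h2.prodMk h3)
  have hbd : ∀ (p : ℝ × ℝ) (h : ℂ), ‖h‖ = 1 → 
      ‖fderiv ℝ ψ (p.1 * unitDir p.2) h‖ ≤ L := by
    intro p h hh
    refine (ContinuousLinearMap.le_opNorm _ _).trans ?_
    rw [hh, mul_one]; exact hL _
  have hz : ∀ (r θ : ℝ), |R| < r → fderiv ℝ ψ (r * unitDir θ) = 0 := by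
    intro r θ h
    apply hD0
    rw [norm_mul, norm_unitDir, mul_one, Complex.norm_real, Real.norm_eq_abs]
    exact (le_abs_self R).trans_lt (h.trans_le (le_abs_self r))
  have hint : ∀ G : ℝ × ℝ → ℂ, Measurable G → (∀ p, ‖G p‖ ≤ L) →
      (∀ r θ, |R| < r → G (r, θ) = 0) →
      IntegrableOn G (Set.Ioi 0 ×ˢ Set.Ioo (-Real.pi) Real.pi) (volume.prod volume) := by
    intro G hG hGL hG0
    have h1 : IntegrableOn G (Set.Ioc 0 |R| ×ˢ Set.Ioo (-Real.pi) Real.pi)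
        (volume.prod volume) := by
      refine Measure.integrableOn_of_bounded (M := L) ?_ hG.aestronglyMeasurable
        (Filter.Eventually.of_forall hGL)
      rw [Measure.prod_prod]
      exact (ENNReal.mul_lt_top (by simp) (by simp)).ne
    refine h1.of_forall_sdiff_eq_zero (measurableSet_Ioi.prod measurableSet_Ioo) ?_
    rintro ⟨r, θ⟩ ⟨⟨hr, hθ⟩, h2⟩
    apply hG0
    by_contra hlt
    exact h2 ⟨⟨hr, not_lt.1 hlt⟩, hθ⟩
  have hiA := hint A hmA (fun p => hbd p _ (norm_unitDir _)) (fun r θ h => by simp [hA, hz r θ h])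
  have hiB := hint B hmB (fun p => hbd p _ (by simp [norm_unitDir]))
    (fun r θ h => by simp [hB, hz r θ h])
  have hd1 : ∀ r θ : ℝ, HasDerivAt (fun r : ℝ => ψ (r * unitDir θ)) (A (r, θ)) r := by
    intro r θ
    have h1 : HasDerivAt (fun r : ℝ => (r : ℂ) * unitDir θ) (unitDir θ) r := by
      simpa using ((hasDerivAt_id r).ofReal_comp).mul_const (unitDir θ)
    exact (hψ (r * unitDir θ)).hasFDerivAt.comp_hasDerivAt r h1
  have hd2 : ∀ r θ : ℝ, HasDerivAt (fun θ : ℝ => ψ (r * unitDir θ)) (r * B (r, θ)) θ := by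
    intro r θ
    have h1 : HasDerivAt (fun θ : ℝ => (r : ℂ) * unitDir θ) ((r : ℝ) • (Complex.I * unitDir θ)) θ := by
      simpa using (hasDerivAt_unitDir θ).const_mul (r : ℂ)
    have := (hψ (r * unitDir θ)).hasFDerivAt.comp_hasDerivAt θ h1
    rw [map_smul] at this
    exact this.congr_deriv (by simp [hB])
  have hIA : ∫ p in Set.Ioi 0 ×ˢ Set.Ioo (-Real.pi) Real.pi, A p ∂(volume.prod volume)
      = -(2 * Real.pi) * ψ 0 := by
    rw [← setIntegral_prod_swap, setIntegral_prod (fun z => A z.swap) hiA.swap]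
    have : ∀ θ : ℝ, ∫ r in Set.Ioi (0 : ℝ), A (Prod.swap (θ, r)) = - ψ 0 := by
      intro θ
      have h0 := integral_Ioi_of_hasDerivAt_of_tendsto (a := 0) (m := 0)
        (f := fun r : ℝ => ψ (r * unitDir θ)) (f' := fun r => A (r, θ))
        (hd1 0 θ).continuousAt.continuousWithinAt (fun r _ => hd1 r θ) ?_ ?_
      · simpa using h0
      · have h1 : IntegrableOn (fun r => A (r, θ)) (Set.Ioc 0 |R|) := by
          refine Measure.integrableOn_of_bounded (M := L) (by simp)
            (hmA.comp (by fun_prop)).aestronglyMeasurable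
            (Filter.Eventually.of_forall fun r => hbd (r, θ) _ (norm_unitDir _))
        refine h1.of_forall_sdiff_eq_zero measurableSet_Ioi ?_
        rintro r ⟨hr, h2⟩
        have : |R| < r := by
          by_contra hlt
          exact h2 ⟨hr, not_lt.1 hlt⟩
        simp [hA, hz r θ this]
      · refine tendsto_const_nhds.congr' ?_
        filter_upwards [Filter.eventually_ge_atTop |R|] with r hr
        symm; apply hR
        rw [norm_mul, norm_unitDir, mul_one, Complex.norm_real, Real.norm_eq_abs]
        exact (le_abs_self R).trans (hr.trans (le_abs_self r))
    simp_rw [this]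
    simp only [integral_const, measureReal_restrict_apply, MeasurableSet.univ, Set.univ_inter]
    simp [Real.pi_pos.le]; left; ring
  have hIB : ∫ p in Set.Ioi 0 ×ˢ Set.Ioo (-Real.pi) Real.pi, B p ∂(volume.prod volume) = 0 := by
    rw [setIntegral_prod _ hiB]
    have : ∀ r ∈ Set.Ioi (0 : ℝ), ∫ θ in Set.Ioo (-Real.pi) Real.pi, B (r, θ) = 0 := by
      intro r hr
      have hr0 : (r : ℂ) ≠ 0 := by exact_mod_cast (ne_of_gt hr)
      have hii : IntervalIntegrable (fun θ => B (r, θ)) volume (-Real.pi) Real.pi := by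
        rw [intervalIntegrable_iff]
        refine Measure.integrableOn_of_bounded (M := L) (by simp)
            (hmB.comp (by fun_prop)).aestronglyMeasurable
            (Filter.Eventually.of_forall fun θ => hbd (r, θ) _ (by simp [norm_unitDir]))
      have h := intervalIntegral.integral_eq_sub_of_hasDerivAt (a := -Real.pi) (b := Real.pi)
        (fun θ _ => hd2 r θ) (hii.const_mul (r : ℂ))
      rw [intervalIntegral.integral_const_mul] at h
      have h3 : unitDir Real.pi = unitDir (-Real.pi) := by simp [unitDir]
      rw [h3, sub_self] at h
      have h4 := (mul_eq_zero.1 h).resolve_left hr0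
      rwa [intervalIntegral.integral_of_le (by linarith [Real.pi_pos]), integral_Ioc_eq_integral_Ioo] at h4
    rw [setIntegral_congr_fun measurableSet_Ioi this]; simp
  rw [← Complex.integral_comp_polarCoord_symm, polarCoord_target]
  have hcong : ∀ p ∈ Set.Ioi (0 : ℝ) ×ˢ Set.Ioo (-Real.pi) Real.pi,
      p.1 • ((fderiv ℝ ψ (Complex.polarCoord.symm p) 1 +
        Complex.I * fderiv ℝ ψ (Complex.polarCoord.symm p) Complex.I) /
          (Complex.polarCoord.symm p)) = A p + Complex.I * B p := by
    rintro ⟨r, θ⟩ ⟨hr, hθ⟩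
    have h := fderiv_apply_unit_combination (fderiv ℝ ψ (r * unitDir θ)) r θ (ne_of_gt hr)
    rw [Complex.polarCoord_symm_apply]
    simp only [Complex.real_smul]
    exact h
  rw [setIntegral_congr_fun (measurableSet_Ioi.prod measurableSet_Ioo) hcong,
    Measure.volume_eq_prod, integral_add hiA (hiB.const_mul _), hIA, integral_const_mul, hIB]
  simp

/-- Cauchy–Pompeiu representation of a compactly supported differentiable function with bounded
derivative. -/
theorem integral_dbar_div_sub {ψ : ℂ → ℂ} (hψ : Differentiable ℝ ψ) {L R : ℝ}
    (hL : ∀ z, ‖fderiv ℝ ψ z‖ ≤ L) (hR : ∀ z, R ≤ ‖z‖ → ψ z = 0) (w : ℂ) :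
    ∫ ζ, (fderiv ℝ ψ ζ 1 + Complex.I * fderiv ℝ ψ ζ Complex.I) / (ζ - w)
      = -(2 * Real.pi) * ψ w := by
  have h := integral_dbar_div_self (ψ := fun z => ψ (z + w)) (L := L) (R := R + ‖w‖)
    (hψ.comp (differentiable_id.add_const w))
    (fun z => by rw [fderiv_comp_add_right]; exact hL _)
    (fun z hz => hR _ (by
      have := norm_sub_norm_le z (-w)
      rw [norm_neg, sub_neg_eq_add] at this
      linarith))
  simp only [fderiv_comp_add_right, zero_add] at h
  rw [← h, ← integral_add_right_eq_self _ w]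
  simp

theorem integrable_comp_norm_complex {f : ℝ → ℝ}
    (h0 : IntegrableOn (fun y => y * f y) (Set.Ioc 0 1))
    (h1 : IntegrableOn (fun y => y * f y) (Set.Ioi 1)) :
    Integrable (fun z : ℂ => f ‖z‖) := by
  rw [integrable_fun_norm_addHaar]
  rw [← Set.Ioc_union_Ioi_eq_Ioi (zero_le_one' ℝ)]
  simpa [Complex.finrank_real_complex] using h0.union h1

theorem integrable_near_kernel {α : ℝ} (hα : α ∈ Set.Ioo (0 : ℝ) 1) :
    Integrable (fun z : ℂ => ‖z‖ ^ (α - 2) * (max ‖z‖ 1)⁻¹) := by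
  obtain ⟨ha, hb⟩ := hα
  refine integrable_comp_norm_complex (f := fun y => y ^ (α - 2) * (max y 1)⁻¹) ?_ ?_
  · have h := (intervalIntegral.intervalIntegrable_rpow' (a := 0) (b := 1) (r := α - 1)
      (by linarith)).1
    refine h.congr_fun ?_ measurableSet_Ioc
    rintro y ⟨hy0, hy1⟩
    have : y ^ (α - 1) = y * y ^ (α - 2) := by
      rw [show α - 1 = 1 + (α - 2) by ring, Real.rpow_add hy0, Real.rpow_one]
    simp [max_eq_right hy1, this]
  · have h := integrableOn_Ioi_rpow_of_lt (a := α - 2) (c := 1) (by linarith) one_pos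
    refine h.congr_fun ?_ measurableSet_Ioi
    intro y hy
    have hy0 : 0 < y := one_pos.trans hy
    simp only [max_eq_left (le_of_lt (Set.mem_Ioi.1 hy))]
    field_simp

theorem integrable_far_kernel {α : ℝ} (hα : α ∈ Set.Ioo (0 : ℝ) 1) :
    Integrable (fun z : ℂ => ‖z‖⁻¹ * (max ‖z‖ 1) ^ (α - 2)) := by
  obtain ⟨ha, hb⟩ := hα
  refine integrable_comp_norm_complex (f := fun y => y⁻¹ * (max y 1) ^ (α - 2)) ?_ ?_
  · have h : IntegrableOn (fun _ : ℝ => (1 : ℝ)) (Set.Ioc 0 1) := integrableOn_const (by simp)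
    refine h.congr_fun ?_ measurableSet_Ioc
    rintro y ⟨hy0, hy1⟩
    simp [max_eq_right hy1, hy0.ne']
  · have h := integrableOn_Ioi_rpow_of_lt (a := α - 2) (c := 1) (by linarith) one_pos
    refine h.congr_fun ?_ measurableSet_Ioi
    intro y hy
    have hy0 : 0 < y := one_pos.trans hy
    simp only [max_eq_left (le_of_lt (Set.mem_Ioi.1 hy))]
    field_simp

theorem rpow_mul_inv_le_of_two_le_add {α a b : ℝ} (hα : α ≤ 2) (ha : 0 ≤ a) (hb : 0 ≤ b)
    (hab : 2 ≤ a + b) :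
    a ^ (α - 2) * b⁻¹ ≤ a ^ (α - 2) * (max a 1)⁻¹ + b⁻¹ * (max b 1) ^ (α - 2) := by
  rcases le_total a b with h | h
  · have : b⁻¹ ≤ (max a 1)⁻¹ :=
      inv_anti₀ (lt_max_of_lt_right one_pos) (max_le h (by linarith))
    have h1 := mul_le_mul_of_nonneg_left this (Real.rpow_nonneg ha (α - 2))
    have : 0 ≤ b⁻¹ * (max b 1) ^ (α - 2) := by positivity
    linarith
  · have : a ^ (α - 2) ≤ (max b 1) ^ (α - 2) :=
      Real.rpow_le_rpow_of_nonpos (lt_max_of_lt_right one_pos) (max_le h (by linarith))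
        (by linarith)
    have h1 := mul_le_mul_of_nonneg_left this (inv_nonneg.2 hb)
    have : 0 ≤ a ^ (α - 2) * (max a 1)⁻¹ := by positivity
    linarith

theorem integrable_two_point_kernel {α : ℝ} (hα : α ∈ Set.Ioo (0 : ℝ) 1) :
    ∃ C, 0 ≤ C ∧ ∀ z : ℂ, z ≠ 0 →
      Integrable (fun ζ : ℂ => ‖ζ‖ ^ (α - 2) * ‖ζ - z‖⁻¹) ∧
      ∫ ζ : ℂ, ‖ζ‖ ^ (α - 2) * ‖ζ - z‖⁻¹ ≤ C * ‖z‖ ^ (α - 1) := by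
  set k₁ : ℂ → ℝ := fun z => ‖z‖ ^ (α - 2) * (max ‖z‖ 1)⁻¹ with hk₁
  set k₂ : ℂ → ℝ := fun z => ‖z‖⁻¹ * (max ‖z‖ 1) ^ (α - 2) with hk₂
  have hi₁ : Integrable k₁ := integrable_near_kernel hα
  have hi₂ : Integrable k₂ := integrable_far_kernel hα
  have hn₁ : 0 ≤ ∫ z, k₁ z := integral_nonneg fun z => by positivity
  have hn₂ : 0 ≤ ∫ z, k₂ z := integral_nonneg fun z => by positivity
  refine ⟨(1 / 2) ^ (α - 1) * ((∫ z, k₁ z) + ∫ z, k₂ z), by positivity, fun z hz => ?_⟩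
  set σ := ‖z‖ / 2 with hσ
  have hσ0 : 0 < σ := by have := norm_pos_iff.2 hz; positivity
  have hj₁ : Integrable fun ζ : ℂ => k₁ (σ⁻¹ • ζ) := hi₁.comp_smul (inv_ne_zero hσ0.ne')
  have hj₂ : Integrable fun ζ : ℂ => k₂ (σ⁻¹ • (ζ - z)) :=
    (hi₂.comp_smul (inv_ne_zero hσ0.ne')).comp_sub_right z
  have hle : ∀ ζ : ℂ, ‖ζ‖ ^ (α - 2) * ‖ζ - z‖⁻¹ ≤
      σ ^ (α - 3) * (k₁ (σ⁻¹ • ζ) + k₂ (σ⁻¹ • (ζ - z))) := by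
    intro ζ
    have ha : ‖σ⁻¹ • ζ‖ = σ⁻¹ * ‖ζ‖ := by
      rw [norm_smul, Real.norm_eq_abs, abs_of_pos (inv_pos.2 hσ0)]
    have hb : ‖σ⁻¹ • (ζ - z)‖ = σ⁻¹ * ‖ζ - z‖ := by
      rw [norm_smul, Real.norm_eq_abs, abs_of_pos (inv_pos.2 hσ0)]
    have h2 : 2 ≤ σ⁻¹ * ‖ζ‖ + σ⁻¹ * ‖ζ - z‖ := by
      rw [← mul_add, inv_mul_eq_div, le_div_iff₀ hσ0]
      have := norm_sub_le ζ (ζ - z)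
      simp only [sub_sub_cancel] at this
      rw [hσ]; linarith
    have h := rpow_mul_inv_le_of_two_le_add (α := α) (by linarith [hα.2]) (by positivity)
      (by positivity) h2
    have h3 := mul_le_mul_of_nonneg_left h (Real.rpow_nonneg hσ0.le (α - 3))
    simp only [hk₁, hk₂, ha, hb]
    refine le_trans (le_of_eq ?_) h3
    rw [Real.mul_rpow (by positivity) (by positivity), Real.inv_rpow hσ0.le, mul_inv, inv_inv,
      show α - 2 = (α - 3) + 1 by ring, Real.rpow_add_one hσ0.ne']
    field_simp
  have hi : Integrable fun ζ : ℂ => σ ^ (α - 3) * (k₁ (σ⁻¹ • ζ) + k₂ (σ⁻¹ • (ζ - z))) :=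
    (hj₁.add hj₂).const_mul _
  have hI : Integrable (fun ζ : ℂ => ‖ζ‖ ^ (α - 2) * ‖ζ - z‖⁻¹) := by
    refine hi.mono' (by fun_prop) (Filter.Eventually.of_forall fun ζ => ?_)
    rw [Real.norm_of_nonneg (by positivity)]
    exact hle ζ
  refine ⟨hI, (integral_mono hI hi hle).trans (le_of_eq ?_)⟩
  rw [integral_const_mul, integral_add hj₁ hj₂,
    integral_sub_right_eq_self (fun ζ => k₂ (σ⁻¹ • ζ)) z, Measure.integral_comp_smul,
    Measure.integral_comp_smul, Complex.finrank_real_complex]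
  have h1 : |((σ⁻¹) ^ 2)⁻¹| = σ ^ 2 := by
    rw [inv_pow, inv_inv, abs_of_pos (by positivity)]
  rw [h1, smul_eq_mul, smul_eq_mul, ← mul_add, ← mul_assoc]
  have h2 : σ ^ (α - 3) * σ ^ 2 = (1 / 2) ^ (α - 1) * ‖z‖ ^ (α - 1) := by
    rw [← Real.mul_rpow (by positivity) (by positivity), ← Real.rpow_natCast σ 2,
      ← Real.rpow_add hσ0, hσ]
    congr 1 <;> push_cast <;> ring
  rw [h2]; ring

theorem integrableOn_norm_rpow_ball {α : ℝ} (hα : α ∈ Set.Ioo (0 : ℝ) 1) :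
    IntegrableOn (fun z : ℂ => ‖z‖ ^ (α - 2)) (Metric.ball 0 1) := by
  refine (integrable_near_kernel hα).integrableOn.congr_fun ?_ measurableSet_ball
  intro z hz
  have : ‖z‖ ≤ 1 := (mem_ball_zero_iff.1 hz).le
  simp [max_eq_right this]

theorem hasFDerivAt_of_norm_sub_le_rpow {X V : Type*} [NormedAddCommGroup X] [NormedSpace ℝ X]
    [NormedAddCommGroup V] [NormedSpace ℝ V] {f : X → V} {P : X →L[ℝ] V} {x : X} {K α : ℝ}
    (hα : 0 < α) (h : ∀ᶠ y in nhds x, ‖f y - f x - P (y - x)‖ ≤ K * ‖y - x‖ ^ (1 + α)) :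
    HasFDerivAt f P x := by
  refine HasFDerivAt.of_isLittleO (Asymptotics.isLittleO_iff.2 fun c hc => ?_)
  have hcont : Filter.Tendsto (fun y => K * ‖y - x‖ ^ α) (nhds x) (nhds (K * ‖x - x‖ ^ α)) := by
    have : Continuous fun y => K * ‖y - x‖ ^ α :=
      continuous_const.mul ((continuous_id.sub continuous_const).norm.rpow_const
        fun _ => Or.inr hα.le)
    exact this.tendsto x
  rw [sub_self, norm_zero, Real.zero_rpow hα.ne', mul_zero] at hcont
  filter_upwards [h, hcont.eventually (ge_mem_nhds hc)] with y hy hy2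
  refine hy.trans ?_
  rw [Real.rpow_add' (norm_nonneg _) (by linarith), Real.rpow_one]
  nlinarith [norm_nonneg (y - x)]

theorem norm_div_sq_le_indicator {α : ℝ} {q : ℂ → ℂ} {Q : ℝ}
    (hq1 : ∀ z, ‖z‖ < 1 → ‖q z‖ ≤ Q * ‖z‖ ^ α) (hq0 : ∀ z, 1 ≤ ‖z‖ → q z = 0) (z : ℂ) :
    ‖q z / z ^ 2‖ ≤ Q * (Metric.ball (0 : ℂ) 1).indicator (fun z => ‖z‖ ^ (α - 2)) z := by
  by_cases h1 : ‖z‖ < 1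
  · rw [Set.indicator_of_mem (mem_ball_zero_iff.2 h1)]
    rcases eq_or_ne z 0 with rfl | h0
    · simp only [ne_eq, OfNat.ofNat_ne_zero, not_false_eq_true, zero_pow, div_zero, norm_zero]
      have := (norm_nonneg _).trans (hq1 (1/2) (by norm_num))
      have h2 : 0 ≤ Q := by
        by_contra hQ
        have h3 : (0:ℝ) < ‖(1/2 : ℂ)‖ ^ α := by norm_num; positivity
        nlinarith
      positivity
    · have hz : 0 < ‖z‖ := norm_pos_iff.2 h0
      rw [norm_div, norm_pow, div_le_iff₀ (by positivity), Real.rpow_sub hz, mul_assoc]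
      refine (hq1 z h1).trans (le_of_eq ?_)
      rw [show (2 : ℝ) = ((2 : ℕ) : ℝ) by norm_num, Real.rpow_natCast]
      field_simp
  · rw [hq0 z (not_lt.1 h1), Set.indicator_of_notMem (by simpa using h1)]
    simp

theorem exists_taylor_bound_of_dbar_le {α : ℝ} (hα : α ∈ Set.Ioo (0 : ℝ) 1) :
    ∃ C, 0 ≤ C ∧ ∀ (ψ : ℂ → ℂ) (Q L : ℝ), Differentiable ℝ ψ → (∀ z, ‖fderiv ℝ ψ z‖ ≤ L) →
      (∀ z, 1 ≤ ‖z‖ → ψ z = 0) → ψ 0 = 0 →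
      (∀ z, ‖z‖ < 1 →
        ‖fderiv ℝ ψ z 1 + Complex.I * fderiv ℝ ψ z Complex.I‖ ≤ Q * ‖z‖ ^ α) →
      (∀ z, 1 ≤ ‖z‖ → fderiv ℝ ψ z 1 + Complex.I * fderiv ℝ ψ z Complex.I = 0) →
      ∃ c : ℂ, ‖c‖ ≤ C * Q ∧ ∀ z, ‖ψ z - c * z‖ ≤ C * Q * ‖z‖ ^ (1 + α) := by
  obtain ⟨C₂, hC₂, hker⟩ := integrable_two_point_kernel hα
  set I₀ := ∫ z in Metric.ball (0 : ℂ) 1, ‖z‖ ^ (α - 2) with hI₀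
  have hI₀n : 0 ≤ I₀ := setIntegral_nonneg measurableSet_ball fun z _ => by positivity
  refine ⟨I₀ + C₂, by positivity, fun ψ Q L hψ hL h1 h0 hq1 hq0 => ?_⟩
  set q : ℂ → ℂ := fun z => fderiv ℝ ψ z 1 + Complex.I * fderiv ℝ ψ z Complex.I with hq
  have hQ : 0 ≤ Q := by
    have := (norm_nonneg _).trans (hq1 (1/2) (by norm_num))
    by_contra hQ
    have h3 : (0:ℝ) < ‖(1/2 : ℂ)‖ ^ α := by norm_num; positivity
    nlinarith
  have hmq : Measurable q := by
    have h1 := measurable_fderiv_apply_const ℝ ψ 1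
    have h2 := measurable_fderiv_apply_const ℝ ψ Complex.I
    fun_prop
  have hbsq := norm_div_sq_le_indicator hq1 hq0
  have hind : Integrable ((Metric.ball (0 : ℂ) 1).indicator (fun z => ‖z‖ ^ (α - 2))) :=
    (integrable_indicator_iff measurableSet_ball).2 (integrableOn_norm_rpow_ball hα)
  have hi2 : Integrable fun z => q z / z ^ 2 :=
    (hind.const_mul Q).mono' (Measurable.aestronglyMeasurable (by measurability)) (Filter.Eventually.of_forall hbsq)
  have hi1 : Integrable fun z => q z / z := by
    refine hi2.norm.mono' (Measurable.aestronglyMeasurable (by measurability)) (Filter.Eventually.of_forall fun z => ?_)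
    by_cases hz : ‖z‖ < 1
    · rcases eq_or_ne z 0 with rfl | hz0
      · simp
      · have : 0 < ‖z‖ := norm_pos_iff.2 hz0
        rw [norm_div, norm_div, norm_pow]
        gcongr
        nlinarith
    · have : q z = 0 := hq0 z (not_lt.1 hz)
      simp [this]
  have hrep := integral_dbar_div_sub hψ hL h1
  have hrep0 : ∫ ζ, q ζ / ζ = 0 := by
    have := hrep 0
    simpa [h0] using this
  have h2pi : (1 : ℝ) ≤ 2 * Real.pi := by linarith [Real.pi_gt_three]
  have h2pin : ‖(-(1 / (2 * Real.pi)) : ℂ)‖ ≤ 1 := by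
    rw [norm_neg, norm_div, norm_one, norm_mul, Complex.norm_real, Real.norm_eq_abs,
      abs_of_pos Real.pi_pos, Complex.norm_ofNat]
    rw [div_le_one (by positivity)]; exact h2pi
  have h2pi0 : (2 * Real.pi : ℂ) ≠ 0 := by
    have : (2 * Real.pi : ℝ) ≠ 0 := by positivity
    exact_mod_cast this
  refine ⟨-(1 / (2 * Real.pi)) * ∫ ζ, q ζ / ζ ^ 2, ?_, fun z => ?_⟩
  · have h3 : ‖∫ ζ, q ζ / ζ ^ 2‖ ≤ Q * I₀ := by
      refine (norm_integral_le_of_norm_le (hind.const_mul Q)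
        (Filter.Eventually.of_forall hbsq)).trans (le_of_eq ?_)
      rw [integral_const_mul, integral_indicator measurableSet_ball]
    calc _ ≤ 1 * (Q * I₀) := by
          rw [norm_mul]; exact mul_le_mul h2pin h3 (norm_nonneg _) zero_le_one
      _ ≤ (I₀ + C₂) * Q := by nlinarith
  · rcases eq_or_ne z 0 with rfl | hz0
    · simp only [h0, mul_zero, sub_zero, norm_zero]
      positivity
    obtain ⟨hk, hkle⟩ := hker z hz0
    have hzp : 0 < ‖z‖ := norm_pos_iff.2 hz0
    have hb3 : ∀ ζ, ‖q ζ * z ^ 2 / ((ζ - z) * ζ ^ 2)‖ ≤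
        Q * ‖z‖ ^ 2 * (‖ζ‖ ^ (α - 2) * ‖ζ - z‖⁻¹) := by
      intro ζ
      have h5 : ‖q ζ / ζ ^ 2‖ ≤ Q * ‖ζ‖ ^ (α - 2) := by
        refine (hbsq ζ).trans (mul_le_mul_of_nonneg_left ?_ hQ)
        exact Set.indicator_le_self' (fun _ _ => by positivity) ζ
      have h6 : ‖q ζ * z ^ 2 / ((ζ - z) * ζ ^ 2)‖ = ‖q ζ / ζ ^ 2‖ * (‖z‖ ^ 2 * ‖ζ - z‖⁻¹) := by
        simp only [norm_div, norm_mul, norm_pow]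
        rw [div_eq_mul_inv, mul_inv]; ring
      rw [h6]
      calc _ ≤ Q * ‖ζ‖ ^ (α - 2) * (‖z‖ ^ 2 * ‖ζ - z‖⁻¹) :=
            mul_le_mul_of_nonneg_right h5 (by positivity)
        _ = _ := by ring
    have hi3 : Integrable fun ζ => q ζ * z ^ 2 / ((ζ - z) * ζ ^ 2) :=
      (hk.const_mul (Q * ‖z‖ ^ 2)).mono' (Measurable.aestronglyMeasurable (by measurability)) (Filter.Eventually.of_forall hb3)
    have hsum : ∫ ζ, q ζ / (ζ - z) =
        (∫ ζ, q ζ / ζ) + z * (∫ ζ, q ζ / ζ ^ 2) + ∫ ζ, q ζ * z ^ 2 / ((ζ - z) * ζ ^ 2) := by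
      rw [← integral_const_mul, ← integral_add hi1 (hi2.const_mul z),
        ← integral_add (f := fun ζ => q ζ / ζ + z * (q ζ / ζ ^ 2))
          (hi1.add (hi2.const_mul z)) hi3]
      refine integral_congr_ae ?_
      have hne : ∀ a : ℂ, ∀ᵐ ζ : ℂ, ζ ≠ a := fun a => by
        rw [ae_iff]; simp
      filter_upwards [hne 0, hne z] with ζ h8 h9
      have h10 : ζ - z ≠ 0 := sub_ne_zero.2 h9
      field_simp
      ring
    have hψz : ψ z - -(1 / (2 * Real.pi)) * (∫ ζ, q ζ / ζ ^ 2) * z =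
        -(1 / (2 * Real.pi)) * ∫ ζ, q ζ * z ^ 2 / ((ζ - z) * ζ ^ 2) := by
      have h11 := hrep z
      rw [show (∫ ζ, (fderiv ℝ ψ ζ 1 + Complex.I * fderiv ℝ ψ ζ Complex.I) / (ζ - z)) =
        ∫ ζ, q ζ / (ζ - z) from rfl, hsum, hrep0] at h11
      generalize (∫ ζ, q ζ * z ^ 2 / ((ζ - z) * ζ ^ 2)) = B at h11 ⊢
      generalize (∫ ζ, q ζ / ζ ^ 2) = A at h11 ⊢
      field_simp
      linear_combination h11
    have h12 : ‖∫ ζ, q ζ * z ^ 2 / ((ζ - z) * ζ ^ 2)‖ ≤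
        Q * ‖z‖ ^ 2 * (C₂ * ‖z‖ ^ (α - 1)) := by
      refine (norm_integral_le_of_norm_le (hk.const_mul _)
        (Filter.Eventually.of_forall hb3)).trans ?_
      rw [integral_const_mul]
      exact mul_le_mul_of_nonneg_left hkle (by positivity)
    have h13 : ‖z‖ ^ 2 * ‖z‖ ^ (α - 1) = ‖z‖ ^ (1 + α) := by
      rw [← Real.rpow_natCast, ← Real.rpow_add hzp]; congr 1; push_cast; ring
    rw [hψz, norm_mul]
    calc _ ≤ 1 * (Q * ‖z‖ ^ 2 * (C₂ * ‖z‖ ^ (α - 1))) :=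
          mul_le_mul h2pin h12 (norm_nonneg _) zero_le_one
      _ = C₂ * Q * ‖z‖ ^ (1 + α) := by rw [← h13]; ring
      _ ≤ _ := by
        gcongr
        linarith

theorem exists_unit_ball_estimate {α : ℝ} (hα : α ∈ Set.Ioo (0 : ℝ) 1) :
    ∃ C, 0 ≤ C ∧ ∀ (φ : ℂ → ℂ) (ω G L : ℝ), 0 ≤ G →
      (∀ z ∈ Metric.ball (0 : ℂ) 1, DifferentiableAt ℝ φ z) →
      (∀ z ∈ Metric.ball (0 : ℂ) 1, ‖fderiv ℝ φ z‖ ≤ L) → φ 0 = 0 →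
      (∀ z ∈ Metric.ball (0 : ℂ) 1, ‖φ z‖ ≤ ω) →
      (∀ z ∈ Metric.ball (0 : ℂ) 1,
        ‖fderiv ℝ φ z 1 + Complex.I * fderiv ℝ φ z Complex.I‖ ≤ G * ‖z‖ ^ α) →
      ‖fderiv ℝ φ 0‖ ≤ C * (ω + G) ∧ ∀ z ∈ Metric.ball (0 : ℂ) 1,
        ‖φ z - fderiv ℝ φ 0 z‖ ≤ C * (ω + G) * ‖z‖ ^ (1 + α) := by
  obtain ⟨C, hC, hmain⟩ := exists_taylor_bound_of_dbar_le hα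
  let χ : ContDiffBump (0 : ℂ) := ⟨1 / 2, 3 / 4, by norm_num, by norm_num⟩
  have hχd : Differentiable ℝ χ := (χ.contDiff (n := 1)).differentiable (by norm_num)
  obtain ⟨C₁, hC₁⟩ := (χ.hasCompactSupport.fderiv (𝕜 := ℝ)).exists_bound_of_continuous
    ((χ.contDiff (n := 1)).continuous_fderiv (by norm_num))
  have hC₁0 : 0 ≤ C₁ := (norm_nonneg _).trans (hC₁ 0)
  have hχ0 : ∀ z : ℂ, 3 / 4 ≤ ‖z‖ → χ z = 0 := fun z hz =>
    χ.zero_of_le_dist (by simpa using hz)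
  have hχ1 : ∀ z : ℂ, ‖z‖ ≤ 1 / 2 → χ z = 1 := fun z hz =>
    χ.one_of_mem_closedBall (by simpa [χ] using hz)
  set C' := C * (1 + 4 * C₁) with hC'
  have hC'0 : 0 ≤ C' := by positivity
  refine ⟨4 * (1 + C'), by positivity, fun φ ω G L hG hφ hL h0 hω hg => ?_⟩
  have hω0 : 0 ≤ ω := (norm_nonneg _).trans (hω 0 (by simp))
  have hL0 : 0 ≤ L := (norm_nonneg _).trans (hL 0 (by simp))
  set ψ : ℂ → ℂ := fun z => χ z • φ z with hψ
  have hψin : ∀ z ∈ Metric.ball (0 : ℂ) 1, HasFDerivAt ψ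
      (χ z • fderiv ℝ φ z + (fderiv ℝ χ z).smulRight (φ z)) z := fun z hz =>
    (hχd z).hasFDerivAt.smul (hφ z hz).hasFDerivAt
  have hψ0 : ∀ z : ℂ, 3 / 4 ≤ ‖z‖ → ψ z = 0 := fun z hz => by simp [hψ, hχ0 z hz]
  have hψout : ∀ z : ℂ, 1 ≤ ‖z‖ → HasFDerivAt ψ (0 : ℂ →L[ℝ] ℂ) z := by
    intro z hz
    have : ψ =ᶠ[nhds z] fun _ => 0 := by
      filter_upwards [continuous_norm.continuousAt.eventually
        (lt_mem_nhds (show (3 / 4 : ℝ) < ‖z‖ by linarith))] with w hw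
      exact hψ0 w hw.le
    exact (hasFDerivAt_const (0 : ℂ) z).congr_of_eventuallyEq this
  have hψd : Differentiable ℝ ψ := fun z => by
    rcases lt_or_ge ‖z‖ 1 with h | h
    · exact (hψin z (mem_ball_zero_iff.2 h)).differentiableAt
    · exact (hψout z h).differentiableAt
  have hψL : ∀ z, ‖fderiv ℝ ψ z‖ ≤ L + C₁ * ω := fun z => by
    rcases lt_or_ge ‖z‖ 1 with h | h
    · have hz := mem_ball_zero_iff.2 h
      rw [(hψin z hz).fderiv]
      refine (norm_add_le _ _).trans (add_le_add ?_ ?_)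
      · rw [norm_smul, Real.norm_of_nonneg χ.nonneg]
        calc _ ≤ 1 * L := mul_le_mul χ.le_one (hL z hz) (norm_nonneg _) zero_le_one
          _ = L := one_mul L
      · rw [ContinuousLinearMap.norm_smulRight_apply]
        exact mul_le_mul (hC₁ z) (hω z hz) (norm_nonneg _) hC₁0
    · rw [(hψout z h).fderiv, norm_zero]; positivity
  have hdχ : ∀ z : ℂ, ‖z‖ < 1 / 2 → fderiv ℝ χ z = 0 := fun z hz => by
    have : (χ : ℂ → ℝ) =ᶠ[nhds z] fun _ => 1 := by
      filter_upwards [continuous_norm.continuousAt.eventually (gt_mem_nhds hz)] with w hw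
      exact hχ1 w (le_of_lt hw)
    rw [this.fderiv_eq]; simp
  have hq : ∀ z, ‖z‖ < 1 → ‖fderiv ℝ ψ z 1 + Complex.I * fderiv ℝ ψ z Complex.I‖ ≤
      (G + 4 * C₁ * ω) * ‖z‖ ^ α := by
    intro z h
    have hz := mem_ball_zero_iff.2 h
    have heq : fderiv ℝ ψ z 1 + Complex.I * fderiv ℝ ψ z Complex.I =
        χ z • (fderiv ℝ φ z 1 + Complex.I * fderiv ℝ φ z Complex.I) +
        (fderiv ℝ χ z 1 + Complex.I * fderiv ℝ χ z Complex.I) * φ z := by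
      rw [(hψin z hz).fderiv]
      simp
      ring
    rw [heq, add_mul G]
    refine (norm_add_le _ _).trans (add_le_add ?_ ?_)
    · rw [norm_smul, Real.norm_of_nonneg χ.nonneg]
      calc _ ≤ 1 * (G * ‖z‖ ^ α) := mul_le_mul χ.le_one (hg z hz) (norm_nonneg _) zero_le_one
        _ = _ := one_mul _
    · rcases lt_or_ge ‖z‖ (1 / 2) with h2 | h2
      · rw [hdχ z h2]; simp; positivity
      · have h3 : (1 / 2 : ℝ) ≤ ‖z‖ ^ α := by
          calc (1 / 2 : ℝ) = (1 / 2) ^ (1 : ℝ) := by norm_num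
            _ ≤ (1 / 2) ^ α := Real.rpow_le_rpow_of_exponent_ge (by norm_num) (by norm_num) hα.2.le
            _ ≤ _ := Real.rpow_le_rpow (by norm_num) h2 hα.1.le
        have h4 : ‖((fderiv ℝ χ z 1 : ℝ) : ℂ) + Complex.I * fderiv ℝ χ z Complex.I‖ ≤ 2 * C₁ := by
          have h5 : ∀ e : ℂ, ‖e‖ = 1 → ‖((fderiv ℝ χ z e : ℝ) : ℂ)‖ ≤ C₁ := fun e he => by
            rw [Complex.norm_real]
            calc _ ≤ ‖fderiv ℝ χ z‖ * ‖e‖ := ContinuousLinearMap.le_opNorm _ _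
              _ ≤ C₁ := by rw [he, mul_one]; exact hC₁ z
          refine (norm_add_le _ _).trans ?_
          rw [norm_mul, Complex.norm_I, one_mul]
          linarith [h5 1 (by simp), h5 Complex.I (by simp)]
        rw [norm_mul]
        calc _ ≤ 2 * C₁ * ω := mul_le_mul h4 (hω z hz) (norm_nonneg _) (by positivity)
          _ = 4 * C₁ * ω * (1 / 2) := by ring
          _ ≤ _ := mul_le_mul_of_nonneg_left h3 (by positivity)
  obtain ⟨c, hc, hcz⟩ := hmain ψ (G + 4 * C₁ * ω) (L + C₁ * ω) hψd hψL
    (fun z hz => hψ0 z (by linarith)) (by simp [hψ, h0]) hq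
    (fun z hz => by rw [(hψout z hz).fderiv]; simp)
  have hQ : C * (G + 4 * C₁ * ω) ≤ C' * (ω + G) := by
    rw [hC', mul_assoc C]
    refine mul_le_mul_of_nonneg_left ?_ hC
    have : 0 ≤ C₁ * G := by positivity
    nlinarith
  set P : ℂ →L[ℝ] ℂ := c • ContinuousLinearMap.id ℝ ℂ with hP
  have hfd : HasFDerivAt φ P 0 := by
    refine hasFDerivAt_of_norm_sub_le_rpow (K := C' * (ω + G)) hα.1 ?_
    filter_upwards [Metric.ball_mem_nhds (0 : ℂ) (show (0 : ℝ) < 1 / 2 by norm_num)] with y hy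
    have hy' : ‖y‖ ≤ 1 / 2 := (mem_ball_zero_iff.1 hy).le
    have h6 := hcz y
    simp only [hψ, hχ1 y hy', one_smul] at h6
    simp only [h0, sub_zero, hP, smul_apply, ContinuousLinearMap.id_apply,
      smul_eq_mul]
    exact h6.trans (mul_le_mul_of_nonneg_right hQ (by positivity))
  have hPc : ‖P‖ ≤ C' * (ω + G) := by
    refine le_trans ?_ (hc.trans hQ)
    refine ContinuousLinearMap.opNorm_le_bound _ (norm_nonneg _) fun x => ?_
    simp [hP]
  have hωG : 0 ≤ ω + G := by positivity
  rw [hfd.fderiv]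
  refine ⟨hPc.trans ?_, fun z hz => ?_⟩
  · nlinarith [mul_nonneg hC'0 hωG]
  · rcases le_or_gt ‖z‖ (1 / 2) with h2 | h2
    · have h6 := hcz z
      simp only [hψ, hχ1 z h2, one_smul] at h6
      simp only [hP, smul_apply, ContinuousLinearMap.id_apply, smul_eq_mul]
      refine h6.trans (mul_le_mul_of_nonneg_right (hQ.trans ?_) (by positivity))
      nlinarith [mul_nonneg hC'0 hωG]
    · have h3 : (1 / 4 : ℝ) ≤ ‖z‖ ^ (1 + α) := by
        calc (1 / 4 : ℝ) = (1 / 2) ^ (2 : ℝ) := by norm_num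
          _ ≤ (1 / 2) ^ (1 + α) :=
            Real.rpow_le_rpow_of_exponent_ge (by norm_num) (by norm_num) (by linarith [hα.2])
          _ ≤ _ := Real.rpow_le_rpow (by norm_num) h2.le (by linarith [hα.1])
      have h7 : ‖P z‖ ≤ C' * (ω + G) := by
        refine (P.le_opNorm z).trans ?_
        calc _ ≤ (C' * (ω + G)) * 1 :=
              mul_le_mul hPc (mem_ball_zero_iff.1 hz).le (norm_nonneg _) (by positivity)
          _ = _ := mul_one _
      calc ‖φ z - P z‖ ≤ ω + C' * (ω + G) := (norm_sub_le _ _).trans (add_le_add (hω z hz) h7)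
        _ ≤ 4 * (1 + C') * (ω + G) * (1 / 4) := by nlinarith
        _ ≤ _ := mul_le_mul_of_nonneg_left h3 (by positivity)

/-- Interior estimate at the centre of a disc for a map that is almost holomorphic with respect to
the constant complex structure `a₀`. -/
theorem exists_centre_estimate {V : Type} [NormedAddCommGroup V] [NormedSpace ℝ V]
    {α : ℝ} (hα : α ∈ Set.Ioo (0 : ℝ) 1) (Λ : ℝ) :
    ∃ C, 0 ≤ C ∧ ∀ (a₀ : V →L[ℝ] V) (v : ℂ → V) (z₀ : ℂ) (s ω G L : ℝ) (f₀ : V),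
      ‖a₀‖ ≤ Λ → (∀ x, a₀ (a₀ x) = -x) → 0 < s → 0 ≤ G →
      (∀ z ∈ Metric.ball z₀ s, DifferentiableAt ℝ v z) →
      (∀ z ∈ Metric.ball z₀ s, ‖fderiv ℝ v z‖ ≤ L) →
      (∀ z ∈ Metric.ball z₀ s, ‖v z - v z₀‖ ≤ ω) →
      (∀ z ∈ Metric.ball z₀ s,
        ‖fderiv ℝ v z 1 + a₀ (fderiv ℝ v z Complex.I) - f₀‖ ≤ G * ‖z - z₀‖ ^ α) →
      ‖fderiv ℝ v z₀‖ ≤ C * (ω / s + ‖f₀‖ + G * s ^ α) ∧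
      ∀ z ∈ Metric.ball z₀ s, ‖v z - v z₀ - fderiv ℝ v z₀ (z - z₀)‖ ≤
        C * (ω / s + ‖f₀‖ + G * s ^ α) * s * (‖z - z₀‖ / s) ^ (1 + α) := by
  obtain ⟨C, hC, hunit⟩ := exists_unit_ball_estimate hα
  refine ⟨C * (1 + |Λ|) + 1, by positivity, fun a₀ v z₀ s ω G L f₀ haΛ ha hs hG hv hL hω hg => ?_⟩
  have hω0 : 0 ≤ ω := (norm_nonneg _).trans (hω z₀ (by simpa using hs))
  set K := ω / s + ‖f₀‖ + G * s ^ α with hK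
  have hK0 : 0 ≤ K := by positivity
  have hmem : ∀ ζ ∈ Metric.ball (0 : ℂ) 1, z₀ + (s : ℂ) * ζ ∈ Metric.ball z₀ s := fun ζ hζ => by
    rw [mem_ball_iff_norm, add_sub_cancel_left, norm_mul, Complex.norm_real,
      Real.norm_of_nonneg hs.le]
    nlinarith [mem_ball_zero_iff.1 hζ]
  have key : ∀ ℓ : V →L[ℝ] ℝ, ‖ℓ‖ ≤ 1 →
      (∀ h, |ℓ (fderiv ℝ v z₀ h)| ≤ (C * (1 + |Λ|) + 1) * K * ‖h‖) ∧
      ∀ z ∈ Metric.ball z₀ s, |ℓ (v z - v z₀ - fderiv ℝ v z₀ (z - z₀))| ≤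
        C * (1 + |Λ|) * K * s * (‖z - z₀‖ / s) ^ (1 + α) := by
    intro ℓ hℓ
    set lam : V →L[ℝ] ℂ := Complex.ofRealCLM.comp ℓ -
      Complex.I • (Complex.ofRealCLM.comp (ℓ.comp a₀)) with hlam
    have hlam_apply : ∀ x, lam x = (ℓ x : ℂ) - Complex.I * ℓ (a₀ x) := fun x => by simp [hlam]
    have hlamI : ∀ x, lam (a₀ x) = Complex.I * lam x := fun x => by
      rw [hlam_apply, hlam_apply, ha, map_neg]
      push_cast
      linear_combination (ℓ (a₀ x) : ℂ) * Complex.I_sq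
    have hre : ∀ x, |ℓ x| ≤ ‖lam x‖ := fun x => by
      have : (lam x).re = ℓ x := by rw [hlam_apply]; simp
      rw [← this]; exact Complex.abs_re_le_norm _
    have hℓx : ∀ x, ‖((ℓ x : ℝ) : ℂ)‖ ≤ ‖x‖ := fun x => by
      rw [Complex.norm_real]
      exact (ℓ.le_opNorm x).trans (mul_le_of_le_one_left (norm_nonneg _) hℓ)
    have hlamn : ∀ x, ‖lam x‖ ≤ (1 + |Λ|) * ‖x‖ := fun x => by
      rw [hlam_apply]
      refine (norm_sub_le _ _).trans ?_
      rw [norm_mul, Complex.norm_I, one_mul, add_mul, one_mul]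
      refine add_le_add (hℓx x) ((hℓx _).trans ((a₀.le_opNorm x).trans ?_))
      exact mul_le_mul_of_nonneg_right (haΛ.trans (le_abs_self _)) (norm_nonneg _)
    set g : ℂ → V := fun ζ => v (z₀ + s * ζ) - v z₀ - (s * ζ.re) • f₀ with hgdef
    have hgd : ∀ ζ ∈ Metric.ball (0 : ℂ) 1, HasFDerivAt g
        (s • fderiv ℝ v (z₀ + s * ζ) - s • Complex.reCLM.smulRight f₀) ζ := by
      intro ζ hζ
      have h1 : HasFDerivAt (fun ζ : ℂ => z₀ + s * ζ) (s • ContinuousLinearMap.id ℝ ℂ) ζ := by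
        have := ((hasFDerivAt_id (𝕜 := ℝ) ζ).const_smul s).const_add z₀
        simpa using this
      have h2 := (hv _ (hmem ζ hζ)).hasFDerivAt.comp ζ h1
      have h3 : HasFDerivAt (fun ζ : ℂ => (s * ζ.re) • f₀) (s • Complex.reCLM.smulRight f₀) ζ := by
        have := (s • Complex.reCLM.smulRight f₀).hasFDerivAt (x := ζ)
        refine this.congr_of_eventuallyEq (Filter.Eventually.of_forall fun w => ?_)
        simp [mul_smul]
      refine ((h2.sub_const (v z₀)).sub h3).congr_fderiv ?_
      ext h; simp
    set φ : ℂ → ℂ := fun ζ => lam (g ζ) with hφ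
    have hφd : ∀ ζ ∈ Metric.ball (0 : ℂ) 1, HasFDerivAt φ
        (lam.comp (s • fderiv ℝ v (z₀ + s * ζ) - s • Complex.reCLM.smulRight f₀)) ζ :=
      fun ζ hζ => lam.hasFDerivAt.comp ζ (hgd ζ hζ)
    obtain ⟨h1, h2⟩ := hunit φ ((1 + |Λ|) * (s * (ω / s + ‖f₀‖)))
      ((1 + |Λ|) * (s * (G * s ^ α))) (‖lam‖ * (s * L + ‖s • Complex.reCLM.smulRight f₀‖))
      (by positivity) (fun ζ hζ => (hφd ζ hζ).differentiableAt) (fun ζ hζ => by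
        rw [(hφd ζ hζ).fderiv]
        refine (ContinuousLinearMap.opNorm_comp_le _ _).trans
          (mul_le_mul_of_nonneg_left ((norm_sub_le _ _).trans ?_) (norm_nonneg _))
        refine add_le_add_left ?_ _
        rw [norm_smul, Real.norm_of_nonneg hs.le]
        exact mul_le_mul_of_nonneg_left (hL _ (hmem ζ hζ)) hs.le) (by simp [hφ, hgdef])
      (fun ζ hζ => by
        refine (hlamn _).trans (mul_le_mul_of_nonneg_left ?_ (by positivity))
        refine (norm_sub_le _ _).trans ?_
        rw [mul_add, mul_div_cancel₀ _ hs.ne']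
        refine add_le_add (hω _ (hmem ζ hζ)) ?_
        rw [norm_smul, norm_mul, Real.norm_of_nonneg hs.le, mul_assoc]
        refine mul_le_mul_of_nonneg_left ?_ hs.le
        exact mul_le_of_le_one_left (norm_nonneg _)
          ((Complex.abs_re_le_norm ζ).trans (mem_ball_zero_iff.1 hζ).le))
      (fun ζ hζ => by
        rw [(hφd ζ hζ).fderiv]
        have : lam.comp (s • fderiv ℝ v (z₀ + s * ζ) - s • Complex.reCLM.smulRight f₀) 1 +
            Complex.I * lam.comp (s • fderiv ℝ v (z₀ + s * ζ) -
              s • Complex.reCLM.smulRight f₀) Complex.I =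
            lam (s • (fderiv ℝ v (z₀ + s * ζ) 1 +
              a₀ (fderiv ℝ v (z₀ + s * ζ) Complex.I) - f₀)) := by
          simp [hlamI]
          ring
        rw [this]
        refine (hlamn _).trans ?_
        rw [norm_smul, Real.norm_of_nonneg hs.le, mul_assoc (1 + |Λ|), mul_assoc s]
        refine mul_le_mul_of_nonneg_left (mul_le_mul_of_nonneg_left ?_ hs.le) (by positivity)
        refine (hg _ (hmem ζ hζ)).trans (le_of_eq ?_)
        rw [add_sub_cancel_left, norm_mul, Complex.norm_real, Real.norm_of_nonneg hs.le,
          Real.mul_rpow hs.le (norm_nonneg _), mul_assoc])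
    have hsum : C * ((1 + |Λ|) * (s * (ω / s + ‖f₀‖)) + (1 + |Λ|) * (s * (G * s ^ α))) =
        C * (1 + |Λ|) * K * s := by rw [hK]; ring
    rw [hsum] at h1 h2
    have hf0 := (hφd 0 (by simp)).fderiv
    rw [hf0] at h1 h2
    simp only [mul_zero, add_zero] at h1 h2
    constructor
    · intro h
      have h3 := (ContinuousLinearMap.le_opNorm _ h).trans
        (mul_le_mul_of_nonneg_right h1 (norm_nonneg h))
      have h4 : lam.comp (s • fderiv ℝ v z₀ - s • Complex.reCLM.smulRight f₀) h =
          s • lam (fderiv ℝ v z₀ h - h.re • f₀) := by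
        simp; ring
      rw [h4, norm_smul, Real.norm_of_nonneg hs.le] at h3
      have h5 : ‖lam (fderiv ℝ v z₀ h - h.re • f₀)‖ ≤ C * (1 + |Λ|) * K * ‖h‖ := by
        refine le_of_mul_le_mul_left (h3.trans (le_of_eq ?_)) hs
        ring
      have h6 := (hre _).trans h5
      rw [map_sub, map_smul, smul_eq_mul] at h6
      have h7 : |h.re * ℓ f₀| ≤ K * ‖h‖ := by
        rw [abs_mul, mul_comm]
        have h8 := hℓx f₀
        rw [Complex.norm_real, Real.norm_eq_abs] at h8
        refine mul_le_mul (h8.trans ?_) (Complex.abs_re_le_norm h) (abs_nonneg _) hK0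
        have h9 : 0 ≤ ω / s := by positivity
        have h10 : 0 ≤ G * s ^ α := by positivity
        linarith
      have h11 := abs_sub_abs_le_abs_sub (ℓ (fderiv ℝ v z₀ h)) (h.re * ℓ f₀)
      nlinarith
    · intro z hz
      have hzs : ‖z - z₀‖ < s := mem_ball_iff_norm.1 hz
      have hζ : (z - z₀) / s ∈ Metric.ball (0 : ℂ) 1 := by
        rw [mem_ball_zero_iff, norm_div, Complex.norm_real, Real.norm_of_nonneg hs.le]
        exact (div_lt_one hs).2 hzs
      have hsc : (s : ℂ) ≠ 0 := by exact_mod_cast hs.ne'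
      have h3 := h2 _ hζ
      have hmulz : (s : ℂ) * ((z - z₀) / s) = z - z₀ := by field_simp
      have hdz : s • ((z - z₀) / s) = z - z₀ := by
        rw [Complex.real_smul]; exact hmulz
      have h4 : φ ((z - z₀) / s) -
          lam.comp (s • fderiv ℝ v z₀ - s • Complex.reCLM.smulRight f₀) ((z - z₀) / s) =
          lam (v z - v z₀ - fderiv ℝ v z₀ (z - z₀)) := by
        have h5 : (s • fderiv ℝ v z₀ - s • Complex.reCLM.smulRight f₀) ((z - z₀) / s) =
            fderiv ℝ v z₀ (z - z₀) - (s * ((z - z₀) / s).re) • f₀ := by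
          rw [sub_apply, smul_apply, smul_apply, ← map_smul, hdz]
          simp [mul_smul]
        rw [ContinuousLinearMap.comp_apply, h5, hφ]
        simp only [hgdef, hmulz]
        rw [← map_sub]
        congr 1
        rw [add_sub_cancel]
        abel
      rw [h4, norm_div, Complex.norm_real, Real.norm_of_nonneg hs.le] at h3
      exact (hre _).trans h3
  have hdual : ∀ (x : V) (B : ℝ), (∀ ℓ : V →L[ℝ] ℝ, ‖ℓ‖ ≤ 1 → |ℓ x| ≤ B) → ‖x‖ ≤ B := by
    intro x B h
    obtain ⟨ℓ, hℓ, hx⟩ := exists_dual_vector'' ℝ x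
    have := h ℓ hℓ
    rw [hx] at this
    simpa using this
  refine ⟨ContinuousLinearMap.opNorm_le_bound _ (by positivity) fun h =>
    hdual _ _ fun ℓ hℓ => (key ℓ hℓ).1 h, fun z hz => hdual _ _ fun ℓ hℓ =>
      ((key ℓ hℓ).2 z hz).trans ?_⟩
  gcongr
  linarith

theorem norm_mul_le_of_forall_half_ball {E : Type*} [NormedAddCommGroup E] {D : ℂ → E}
    {z₁ : ℂ} {R K : ℝ} (hR : 0 < R) (hbdd : ∃ B, ∀ z ∈ Metric.ball z₁ R, ‖D z‖ ≤ B)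
    (h : ∀ z₀ ∈ Metric.ball z₁ R, ∀ L, 0 ≤ L →
      (∀ z ∈ Metric.ball z₀ ((R - dist z₀ z₁) / 2), ‖D z‖ ≤ L) →
      ‖D z₀‖ ≤ K / (R - dist z₀ z₁) + L / 8) :
    ∀ z ∈ Metric.ball z₁ R, ‖D z‖ * (R - dist z z₁) ≤ 2 * K := by
  obtain ⟨B, hB⟩ := hbdd
  set S : Set ℝ := (fun z => ‖D z‖ * (R - dist z z₁)) '' Metric.ball z₁ R with hS
  have hSb : BddAbove S := by
    refine ⟨B * R, ?_⟩
    rintro _ ⟨z, hz, rfl⟩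
    have h1 := hB z hz
    have h2 : dist z z₁ < R := hz
    exact mul_le_mul h1 (by linarith [dist_nonneg (x := z) (y := z₁)]) (by linarith)
      ((norm_nonneg _).trans h1)
  set M := sSup S with hM
  have hle : ∀ z ∈ Metric.ball z₁ R, ‖D z‖ * (R - dist z z₁) ≤ M := fun z hz =>
    le_csSup hSb ⟨z, hz, rfl⟩
  have hz1 : z₁ ∈ Metric.ball z₁ R := Metric.mem_ball_self hR
  have hM0 : 0 ≤ M := le_trans (by simp; positivity) (hle z₁ hz1)
  have himp : M ≤ K + M / 4 := by
    refine csSup_le ⟨_, z₁, hz1, rfl⟩ ?_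
    rintro _ ⟨z₀, hz₀, rfl⟩
    have hd : 0 < R - dist z₀ z₁ := by linarith [Metric.mem_ball.1 hz₀]
    have h1 := h z₀ hz₀ (2 * M / (R - dist z₀ z₁)) (by positivity) (fun z hz => by
      have h2 : dist z z₁ ≤ dist z z₀ + dist z₀ z₁ := dist_triangle _ _ _
      have h3 := Metric.mem_ball.1 hz
      have h4 : (R - dist z₀ z₁) / 2 ≤ R - dist z z₁ := by linarith
      have h5 := hle z (by rw [Metric.mem_ball]; linarith)
      rw [le_div_iff₀ hd]
      nlinarith [norm_nonneg (D z)])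
    calc ‖D z₀‖ * (R - dist z₀ z₁)
        ≤ (K / (R - dist z₀ z₁) + 2 * M / (R - dist z₀ z₁) / 8) * (R - dist z₀ z₁) :=
          mul_le_mul_of_nonneg_right h1 hd.le
      _ = K + M / 4 := by field_simp; ring
  intro z hz
  have := hle z hz
  linarith

theorem norm_sub_le_of_taylor_bound {X V : Type*} [NormedAddCommGroup X] [NormedSpace ℝ X]
    [NormedAddCommGroup V] [NormedSpace ℝ V] {v : X → V} {D : X → X →L[ℝ] V} {S : Set X}
    {s K L α : ℝ} (hs : 0 < s) (hK : 0 ≤ K) (hα : α ∈ Set.Ioo (0 : ℝ) 1)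
    (hT : ∀ z₀ ∈ S, ∀ z ∈ Metric.ball z₀ s,
      ‖v z - v z₀ - D z₀ (z - z₀)‖ ≤ K * ‖z - z₀‖ ^ (1 + α))
    (hL : ∀ z ∈ S, ‖D z‖ ≤ L) {z z' : X} (hz : z ∈ S) (hz' : z' ∈ S) :
    ‖D z - D z'‖ ≤ (6 * K + 2 * L * (2 / s) ^ α) * ‖z - z'‖ ^ α := by
  have hL0 : 0 ≤ L := (norm_nonneg _).trans (hL z hz)
  set ρ := ‖z - z'‖ with hρ
  have hρ0 : 0 ≤ ρ := norm_nonneg _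
  rcases eq_or_ne z z' with rfl | hne
  · rw [sub_self, norm_zero]; positivity
  have hρpos : 0 < ρ := norm_pos_iff.2 (sub_ne_zero.2 hne)
  rw [add_mul]
  rcases lt_or_ge ρ (s / 2) with hlt | hge
  · refine le_trans ?_ (le_add_of_nonneg_right (by positivity))
    refine ContinuousLinearMap.opNorm_le_of_unit_norm (by positivity) fun x hx => ?_
    have hn : ‖ρ • x‖ = ρ := by rw [norm_smul, hx, mul_one, Real.norm_of_nonneg hρ0]
    have e1 := hT z hz (z + ρ • x) (by rw [mem_ball_iff_norm, add_sub_cancel_left, hn]; linarith)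
    have hle2 : ‖z + ρ • x - z'‖ ≤ 2 * ρ := by
      rw [show z + ρ • x - z' = (z - z') + ρ • x by abel]
      refine (norm_add_le _ _).trans ?_
      rw [hn]; linarith
    have e2 := hT z' hz' (z + ρ • x) (by rw [mem_ball_iff_norm]; linarith)
    have e3 := hT z' hz' z (by rw [mem_ball_iff_norm]; linarith)
    rw [add_sub_cancel_left, hn] at e1
    have h4 : ‖z + ρ • x - z'‖ ^ (1 + α) ≤ 4 * ρ ^ (1 + α) := by
      calc _ ≤ (2 * ρ) ^ (1 + α) := Real.rpow_le_rpow (norm_nonneg _) hle2 (by linarith [hα.1])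
        _ = 2 ^ (1 + α) * ρ ^ (1 + α) := Real.mul_rpow (by norm_num) hρ0
        _ ≤ 2 ^ (2 : ℝ) * ρ ^ (1 + α) := by
            refine mul_le_mul_of_nonneg_right ?_ (by positivity)
            exact Real.rpow_le_rpow_of_exponent_le (by norm_num) (by linarith [hα.2])
        _ = _ := by norm_num
    have heq : ρ • ((D z - D z') x) = (v (z + ρ • x) - v z' - D z' (z + ρ • x - z')) -
        (v (z + ρ • x) - v z - D z (ρ • x)) - (v z - v z' - D z' (z - z')) := by
      simp only [map_sub, map_add, map_smul, sub_apply, smul_sub]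
      abel
    have hfin : ρ * ‖(D z - D z') x‖ ≤ 6 * K * ρ ^ (1 + α) := by
      rw [← Real.norm_of_nonneg hρ0, ← norm_smul, heq, Real.norm_of_nonneg hρ0]
      refine (norm_sub_le _ _).trans ?_
      have := norm_sub_le (v (z + ρ • x) - v z' - D z' (z + ρ • x - z'))
        (v (z + ρ • x) - v z - D z (ρ • x))
      have h5 := mul_le_mul_of_nonneg_left h4 hK
      linarith
    rw [Real.rpow_add hρpos, Real.rpow_one] at hfin
    have : ρ * ‖(D z - D z') x‖ ≤ ρ * (6 * K * ρ ^ α) := by linarith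
    exact le_of_mul_le_mul_left this hρpos
  · refine le_trans ?_ (le_add_of_nonneg_left (by positivity))
    have h1 : 1 ≤ (2 / s) ^ α * ρ ^ α := by
      rw [← Real.mul_rpow (by positivity) hρ0]
      refine Real.one_le_rpow ?_ hα.1.le
      rw [div_mul_eq_mul_div, le_div_iff₀ hs]; linarith
    calc ‖D z - D z'‖ ≤ 2 * L := by
          refine (norm_sub_le _ _).trans ?_
          linarith [hL z hz, hL z' hz']
      _ ≤ 2 * L * ((2 / s) ^ α * ρ ^ α) := le_mul_of_one_le_right (by positivity) h1
      _ = _ := by ring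

theorem exists_pos_mul_rpow_le {α : ℝ} (hα : 0 < α) {B ε : ℝ} (hB : 0 ≤ B) (hε : 0 < ε) :
    ∃ c > 0, B * c ^ α ≤ ε := by
  refine ⟨(ε / (B + 1)) ^ α⁻¹, by positivity, ?_⟩
  rw [Real.rpow_inv_rpow (by positivity) hα.ne', mul_div_assoc', div_le_iff₀ (by positivity)]
  nlinarith

theorem norm_apply_unit_le {V : Type*} [NormedAddCommGroup V] [NormedSpace ℝ V]
    (D : ℂ →L[ℝ] V) {e : ℂ} (he : ‖e‖ = 1) : ‖D e‖ ≤ ‖D‖ := by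
  simpa [he] using D.le_opNorm e

/-- Gradient estimate for pseudoholomorphic maps of small oscillation whose differential is a
priori bounded by an unspecified constant. -/
theorem exists_gradient_estimate {V : Type} [NormedAddCommGroup V] [NormedSpace ℝ V]
    {α : ℝ} (hα : α ∈ Set.Ioo (0 : ℝ) 1) {J : V → V →L[ℝ] V} {Λ H : ℝ}
    (hΛ : ∀ x, ‖J x‖ ≤ Λ) (hH0 : 0 ≤ H) (hH : ∀ x x', ‖J x - J x'‖ ≤ H * ‖x - x'‖ ^ α)
    (hsq : ∀ x v, J x (J x v) = -v) :
    ∃ δ > 0, ∃ C, 0 ≤ C ∧ ∀ (u : ℂ → V) (z₁ : ℂ) (R ω : ℝ), 0 < R →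
      (∀ z ∈ Metric.ball z₁ R, DifferentiableAt ℝ u z) →
      (∃ B, ∀ z ∈ Metric.ball z₁ R, ‖fderiv ℝ u z‖ ≤ B) →
      (∀ z ∈ Metric.ball z₁ R, fderiv ℝ u z 1 + J (u z) (fderiv ℝ u z Complex.I) = 0) →
      (∀ z ∈ Metric.ball z₁ R, ∀ z' ∈ Metric.ball z₁ R, ‖u z - u z'‖ ≤ ω) → ω < δ →
      ∀ z ∈ Metric.ball z₁ R, ‖fderiv ℝ u z‖ * (R - dist z z₁) ≤ C * ω := by
  obtain ⟨C, hC, hest⟩ := exists_centre_estimate (V := V) hα Λ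
  obtain ⟨c, hc, hcle⟩ := exists_pos_mul_rpow_le hα.1 (B := C * H) (ε := 1 / 16)
    (by positivity) (by norm_num)
  refine ⟨c / (16 * (C + 1)), by positivity, 4 * C, by positivity,
    fun u z₁ R ω hR hu hbdd hJ hω hδ z hz => ?_⟩
  have hω0 : 0 ≤ ω := (norm_nonneg _).trans (hω z hz z hz)
  rw [lt_div_iff₀ (by positivity)] at hδ
  have hkey := norm_mul_le_of_forall_half_ball (K := 2 * C * ω) hR hbdd
    (fun z₀ hz₀ L hL0 hL => ?_) z hz
  · linarith
  set d := R - dist z₀ z₁ with hd_def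
  have hd : 0 < d := by linarith [Metric.mem_ball.1 hz₀]
  rcases eq_or_lt_of_le hL0 with rfl | hLpos
  · refine (hL z₀ (Metric.mem_ball_self (by linarith))).trans ?_
    positivity
  set s := min (d / 2) (c / L) with hs_def
  have hs : 0 < s := lt_min (by positivity) (by positivity)
  have hsub : Metric.ball z₀ s ⊆ Metric.ball z₀ (d / 2) :=
    Metric.ball_subset_ball (min_le_left _ _)
  have hsub' : Metric.ball z₀ s ⊆ Metric.ball z₁ R := by
    refine hsub.trans (Metric.ball_subset_ball' ?_)
    linarith
  have hLs : L * s ≤ c := by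
    calc L * s ≤ L * (c / L) := mul_le_mul_of_nonneg_left (min_le_right _ _) hL0
      _ = c := by field_simp
  obtain ⟨h1, -⟩ := hest (J (u z₀)) u z₀ s ω (H * L ^ α * L) L 0 (hΛ _) (hsq _) hs
    (by positivity) (fun w hw => hu w (hsub' hw)) (fun w hw => hL w (hsub hw))
    (fun w hw => hω w (hsub' hw) z₀ hz₀) (fun w hw => by
      have hlip : ‖u w - u z₀‖ ≤ L * ‖w - z₀‖ :=
        (convex_ball z₀ s).norm_image_sub_le_of_norm_fderiv_le
          (fun x hx => hu x (hsub' hx)) (fun x hx => hL x (hsub hx))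
          (Metric.mem_ball_self hs) hw
      have heq : fderiv ℝ u w 1 + J (u z₀) (fderiv ℝ u w Complex.I) - 0 =
          (J (u z₀) - J (u w)) (fderiv ℝ u w Complex.I) := by
        rw [sub_apply, sub_zero, eq_neg_of_add_eq_zero_left (hJ w (hsub' hw))]
        abel
      rw [heq]
      refine (ContinuousLinearMap.le_opNorm _ _).trans ?_
      calc _ ≤ (H * (L * ‖w - z₀‖) ^ α) * L := by
            refine mul_le_mul ?_ ((norm_apply_unit_le _ Complex.norm_I).trans (hL w (hsub hw)))
              (norm_nonneg _) (by positivity)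
            refine (hH _ _).trans (mul_le_mul_of_nonneg_left ?_ hH0)
            rw [norm_sub_rev]
            exact Real.rpow_le_rpow (norm_nonneg _) hlip hα.1.le
        _ = _ := by rw [Real.mul_rpow hL0 (norm_nonneg _)]; ring)
  rw [norm_zero, add_zero] at h1
  have hG : C * (H * L ^ α * L * s ^ α) ≤ L / 16 := by
    calc _ = L * (C * H * (L * s) ^ α) := by rw [Real.mul_rpow hL0 hs.le]; ring
      _ ≤ L * (C * H * c ^ α) := by
        refine mul_le_mul_of_nonneg_left (mul_le_mul_of_nonneg_left ?_ (by positivity)) hL0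
        exact Real.rpow_le_rpow (by positivity) hLs hα.1.le
      _ ≤ L * (1 / 16) := mul_le_mul_of_nonneg_left hcle hL0
      _ = _ := by ring
  have hωs : ω / s ≤ 2 * ω / d + ω * L / c := by
    rcases min_choice (d / 2) (c / L) with h | h
    · rw [hs_def, h, show ω / (d / 2) = 2 * ω / d by field_simp]
      exact le_add_of_nonneg_right (by positivity)
    · rw [hs_def, h, show ω / (c / L) = ω * L / c by field_simp]
      exact le_add_of_nonneg_left (by positivity)
  have hCω : C * (ω * L / c) ≤ L / 16 := by
    rw [mul_div_assoc', div_le_iff₀ hc]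
    nlinarith
  calc _ ≤ C * (2 * ω / d + ω * L / c) + L / 16 := by
        rw [mul_add] at h1
        exact h1.trans (add_le_add (mul_le_mul_of_nonneg_left hωs hC) hG)
    _ = 2 * C * ω / d + C * (ω * L / c) + L / 16 := by ring
    _ ≤ _ := by linarith

/-- Interior `C^{1,α}` estimate for a linear Cauchy-Riemann equation. -/
theorem exists_linear_estimate {V : Type} [NormedAddCommGroup V] [NormedSpace ℝ V]
    {α : ℝ} (hα : α ∈ Set.Ioo (0 : ℝ) 1) {Λ r' r : ℝ} (hΛ : 0 ≤ Λ) (hr : r' < r) :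
    ∃ C, 0 ≤ C ∧ ∀ (a : ℂ → V →L[ℝ] V) (v f : ℂ → V) (N : ℝ),
      (∀ z ∈ Metric.ball (0 : ℂ) r, DifferentiableAt ℝ v z) →
      (∃ B, ∀ z ∈ Metric.ball (0 : ℂ) r, ‖fderiv ℝ v z‖ ≤ B) →
      (∀ z ∈ Metric.ball (0 : ℂ) r, fderiv ℝ v z 1 + a z (fderiv ℝ v z Complex.I) = f z) →
      (∀ z x, a z (a z x) = -x) →
      (∀ z ∈ Metric.ball (0 : ℂ) r, ‖a z‖ ≤ Λ) →
      (∀ z ∈ Metric.ball (0 : ℂ) r, ∀ z' ∈ Metric.ball (0 : ℂ) r,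
        ‖a z - a z'‖ ≤ Λ * ‖z - z'‖ ^ α) →
      (∀ z ∈ Metric.ball (0 : ℂ) r, ‖v z‖ ≤ N) →
      (∀ z ∈ Metric.ball (0 : ℂ) r, ‖f z‖ ≤ N) →
      (∀ z ∈ Metric.ball (0 : ℂ) r, ∀ z' ∈ Metric.ball (0 : ℂ) r,
        ‖f z - f z'‖ ≤ N * ‖z - z'‖ ^ α) →
      (∀ z ∈ Metric.ball (0 : ℂ) r', ‖fderiv ℝ v z‖ ≤ C * N) ∧
      (∀ z ∈ Metric.ball (0 : ℂ) r', ∀ z' ∈ Metric.ball (0 : ℂ) r',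
        ‖fderiv ℝ v z - fderiv ℝ v z'‖ ≤ C * N * ‖z - z'‖ ^ α) := by
  rcases le_or_gt r' 0 with hr0 | hr0
  · refine ⟨0, le_rfl, fun a v f N _ _ _ _ _ _ _ _ _ => ?_⟩
    simp [Metric.ball_eq_empty.2 hr0]
  have hrpos : 0 < r := hr0.trans hr
  obtain ⟨C, hC, hest⟩ := exists_centre_estimate (V := V) hα Λ
  obtain ⟨c, hc, hcle⟩ := exists_pos_mul_rpow_le hα.1 (B := C * Λ) (ε := 1 / 8)
    (by positivity) (by norm_num)
  set K₀ := C * (4 + r * (2 / c + 1 + c ^ α)) with hK₀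
  set t := (r - r') / 2 with ht
  have htpos : 0 < t := by rw [ht]; linarith
  set C₁ := 2 * K₀ / t with hC₁
  have hK₀n : 0 ≤ K₀ := by positivity
  have hC₁n : 0 ≤ C₁ := by positivity
  set C₂ := C * (2 / t + 1 + (1 + Λ * C₁) * t ^ α) * t * (1 / t) ^ (1 + α) with hC₂
  have hC₂n : 0 ≤ C₂ := by positivity
  refine ⟨C₁ + (6 * C₂ + 2 * C₁ * (2 / t) ^ α), by positivity,
    fun a v f N hv hbdd heq hsq haΛ haH hvN hfN hfH => ?_⟩
  have hN : 0 ≤ N := (norm_nonneg _).trans (hvN 0 (Metric.mem_ball_self hrpos))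
  have hrhs : ∀ z₀ ∈ Metric.ball (0 : ℂ) r, ∀ s L, 0 ≤ L →
      Metric.ball z₀ s ⊆ Metric.ball (0 : ℂ) r →
      (∀ z ∈ Metric.ball z₀ s, ‖fderiv ℝ v z‖ ≤ L) → ∀ w ∈ Metric.ball z₀ s,
      ‖fderiv ℝ v w 1 + a z₀ (fderiv ℝ v w Complex.I) - f z₀‖ ≤ (N + Λ * L) * ‖w - z₀‖ ^ α := by
    intro z₀ hz₀ s L hL0 hsub hL w hw
    have h1 : fderiv ℝ v w 1 + a z₀ (fderiv ℝ v w Complex.I) - f z₀ =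
        (f w - f z₀) - (a w - a z₀) (fderiv ℝ v w Complex.I) := by
      rw [sub_apply, ← heq w (hsub hw)]; abel
    rw [h1]
    refine (norm_sub_le _ _).trans ?_
    rw [add_mul]
    refine add_le_add (hfH w (hsub hw) z₀ hz₀) ((ContinuousLinearMap.le_opNorm _ _).trans ?_)
    calc _ ≤ (Λ * ‖w - z₀‖ ^ α) * L :=
          mul_le_mul (haH w (hsub hw) z₀ hz₀)
            ((norm_apply_unit_le _ Complex.norm_I).trans (hL w hw)) (norm_nonneg _) (by positivity)
      _ = _ := by ring
  have hosc : ∀ z ∈ Metric.ball (0 : ℂ) r, ∀ z' ∈ Metric.ball (0 : ℂ) r,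
      ‖v z - v z'‖ ≤ 2 * N := fun z hz z' hz' =>
    (norm_sub_le _ _).trans (by linarith [hvN z hz, hvN z' hz'])
  have hgrad : ∀ z ∈ Metric.ball (0 : ℂ) r,
      ‖fderiv ℝ v z‖ * (r - dist z 0) ≤ 2 * (K₀ * N) := by
    refine norm_mul_le_of_forall_half_ball hrpos hbdd fun z₀ hz₀ L hL0 hL => ?_
    set d := r - dist z₀ 0 with hd_def
    have hd : 0 < d := by linarith [Metric.mem_ball.1 hz₀]
    have hdr : d ≤ r := by linarith [dist_nonneg (x := z₀) (y := 0)]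
    set s := min (d / 2) c with hs_def
    have hs : 0 < s := lt_min (by positivity) hc
    have hsub : Metric.ball z₀ s ⊆ Metric.ball z₀ (d / 2) :=
      Metric.ball_subset_ball (min_le_left _ _)
    have hsub' : Metric.ball z₀ s ⊆ Metric.ball 0 r := by
      refine hsub.trans (Metric.ball_subset_ball' ?_)
      linarith
    obtain ⟨h1, -⟩ := hest (a z₀) v z₀ s (2 * N) (N + Λ * L) L (f z₀) (haΛ _ hz₀) (hsq _) hs
      (by positivity) (fun w hw => hv w (hsub' hw)) (fun w hw => hL w (hsub hw))
      (fun w hw => hosc w (hsub' hw) z₀ hz₀)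
      (hrhs z₀ hz₀ s L hL0 hsub' fun w hw => hL w (hsub hw))
    have hsα : s ^ α ≤ c ^ α := Real.rpow_le_rpow hs.le (min_le_right _ _) hα.1.le
    have hωs : 2 * N / s ≤ 4 * N / d + 2 * N / c := by
      rcases min_choice (d / 2) c with h | h
      · rw [hs_def, h, show 2 * N / (d / 2) = 4 * N / d by field_simp; ring]
        exact le_add_of_nonneg_right (by positivity)
      · rw [hs_def, h]
        exact le_add_of_nonneg_left (by positivity)
    calc _ ≤ C * (2 * N / s + ‖f z₀‖ + (N + Λ * L) * s ^ α) := h1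
      _ ≤ C * (4 * N / d + 2 * N / c + N + (N + Λ * L) * c ^ α) := by
        refine mul_le_mul_of_nonneg_left ?_ hC
        exact add_le_add (add_le_add hωs (hfN _ hz₀)) (mul_le_mul_of_nonneg_left hsα (by positivity))
      _ = C * 4 * N / d + C * (2 / c + 1 + c ^ α) * N + L * (C * Λ * c ^ α) := by ring
      _ ≤ C * 4 * N / d + C * (2 / c + 1 + c ^ α) * N * (r / d) + L * (1 / 8) := by
        refine add_le_add (add_le_add_right ?_ _) (mul_le_mul_of_nonneg_left hcle hL0)
        exact le_mul_of_one_le_right (by positivity) ((one_le_div hd).2 hdr)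
      _ = _ := by rw [hK₀]; ring
  have hmid : ∀ z, dist z 0 < r' + t → ‖fderiv ℝ v z‖ ≤ C₁ * N := fun z hz => by
    have h1 : t ≤ r - dist z 0 := by rw [ht] at hz ⊢; linarith
    have h2 := hgrad z (by rw [Metric.mem_ball]; linarith)
    rw [hC₁, div_mul_eq_mul_div, le_div_iff₀ htpos]
    nlinarith [norm_nonneg (fderiv ℝ v z)]
  have hin : ∀ z ∈ Metric.ball (0 : ℂ) r', ‖fderiv ℝ v z‖ ≤ C₁ * N := fun z hz =>
    hmid z (by linarith [Metric.mem_ball.1 hz])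
  have htaylor : ∀ z₀ ∈ Metric.ball (0 : ℂ) r', ∀ z ∈ Metric.ball z₀ t,
      ‖v z - v z₀ - fderiv ℝ v z₀ (z - z₀)‖ ≤ C₂ * N * ‖z - z₀‖ ^ (1 + α) := by
    intro z₀ hz₀ z hz
    have hz₀r : z₀ ∈ Metric.ball (0 : ℂ) r := Metric.ball_subset_ball hr.le hz₀
    have hdist : ∀ w ∈ Metric.ball z₀ t, dist w 0 < r' + t := fun w hw => by
      have := dist_triangle w z₀ 0
      linarith [Metric.mem_ball.1 hw, Metric.mem_ball.1 hz₀]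
    have hsub : Metric.ball z₀ t ⊆ Metric.ball 0 r := fun w hw => by
      rw [Metric.mem_ball]
      have := hdist w hw
      rw [ht] at this; linarith
    obtain ⟨-, h1⟩ := hest (a z₀) v z₀ t (2 * N) (N + Λ * (C₁ * N)) (C₁ * N) (f z₀) (haΛ _ hz₀r)
      (hsq _) htpos (by positivity) (fun w hw => hv w (hsub hw))
      (fun w hw => hmid w (hdist w hw)) (fun w hw => hosc w (hsub hw) z₀ hz₀r)
      (hrhs z₀ hz₀r t _ (by positivity) hsub fun w hw => hmid w (hdist w hw))
    refine (h1 z hz).trans ?_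
    rw [div_eq_mul_one_div ‖z - z₀‖, Real.mul_rpow (norm_nonneg _) (by positivity)]
    calc _ ≤ C * (2 * N / t + N + (N + Λ * (C₁ * N)) * t ^ α) * t *
          (‖z - z₀‖ ^ (1 + α) * (1 / t) ^ (1 + α)) := by
          gcongr
          exact hfN _ hz₀r
      _ = _ := by rw [hC₂]; ring
  refine ⟨fun z hz => (hin z hz).trans (mul_le_mul_of_nonneg_right ?_ hN), fun z hz z' hz' => ?_⟩
  · exact le_add_of_nonneg_right (by positivity)
  · refine (norm_sub_le_of_taylor_bound htpos (by positivity) hα htaylor hin hz hz').trans ?_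
    refine mul_le_mul_of_nonneg_right ?_ (by positivity)
    have : 0 ≤ C₁ * N := by positivity
    linarith

theorem IsCompact.exists_bound_of_eventually_bound {X E : Type*} [TopologicalSpace X]
    [NormedAddCommGroup E] {K : Set X} (hK : IsCompact K) {D : X → E}
    (h : ∀ z ∈ K, ∃ B, ∀ᶠ w in nhds z, ‖D w‖ ≤ B) : ∃ B, ∀ z ∈ K, ‖D z‖ ≤ B := by
  refine hK.induction_on (p := fun S => ∃ B, ∀ z ∈ S, ‖D z‖ ≤ B) ⟨0, by simp⟩ ?_ ?_ ?_
  · rintro S T hST ⟨B, hB⟩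
    exact ⟨B, fun z hz => hB z (hST hz)⟩
  · rintro S T ⟨B, hB⟩ ⟨B', hB'⟩
    refine ⟨max B B', fun z hz => ?_⟩
    rcases hz with hz | hz
    · exact (hB z hz).trans (le_max_left _ _)
    · exact (hB' z hz).trans (le_max_right _ _)
  · intro z hz
    obtain ⟨B, hB⟩ := h z hz
    exact ⟨_, mem_nhdsWithin_of_mem_nhds hB, B, fun w hw => hw⟩

/-- A map satisfying a scale-invariant a priori gradient estimate has locally bounded
differential. -/
theorem eventually_norm_fderiv_le {V : Type*} [NormedAddCommGroup V] [NormedSpace ℝ V]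
    {u : ℂ → V} {δ C ω₀ : ℝ} (hC : 0 ≤ C)
    (hu : ∀ z ∈ Metric.ball (0 : ℂ) 1, DifferentiableAt ℝ u z)
    (hosc : ∀ z ∈ Metric.ball (0 : ℂ) 1, ∀ z' ∈ Metric.ball (0 : ℂ) 1, ‖u z - u z'‖ ≤ ω₀)
    (hδ : ω₀ < δ)
    (hest : ∀ (z₁ : ℂ) (R ω : ℝ), 0 < R → Metric.ball z₁ R ⊆ Metric.ball 0 1 →
      (∃ B, ∀ z ∈ Metric.ball z₁ R, ‖fderiv ℝ u z‖ ≤ B) →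
      (∀ z ∈ Metric.ball z₁ R, ∀ z' ∈ Metric.ball z₁ R, ‖u z - u z'‖ ≤ ω) → ω < δ →
      ∀ z ∈ Metric.ball z₁ R, ‖fderiv ℝ u z‖ * (R - dist z z₁) ≤ C * ω) :
    ∀ z ∈ Metric.ball (0 : ℂ) 1, ∃ B, ∀ᶠ w in nhds z, ‖fderiv ℝ u w‖ ≤ B := by
  set Gd : Set ℂ := {z | ∃ B, ∀ᶠ w in nhds z, ‖fderiv ℝ u w‖ ≤ B} with hGd
  have hGo : IsOpen Gd := isOpen_iff_mem_nhds.2 fun z hz => by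
    obtain ⟨B, hB⟩ := hz
    exact hB.eventually_nhds.mono fun w hw => ⟨B, hw⟩
  set P : Set ℂ := Metric.ball 0 1 ∩ Gdᶜ with hP
  intro z₀ hz₀
  by_contra hcon
  have hz₀P : z₀ ∈ P := ⟨hz₀, hcon⟩
  have hPlc : IsLocallyClosed P := Metric.isOpen_ball.isLocallyClosed.inter
    hGo.isClosed_compl.isLocallyClosed
  have : LocallyCompactSpace P := hPlc.locallyCompactSpace
  have : Nonempty P := ⟨⟨z₀, hz₀P⟩⟩
  set E : ℕ → Set P := fun m => {z | ∀ w ∈ Metric.ball (0 : ℂ) 1, ‖w - z‖ < 1 / ((m : ℝ) + 1) →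
    ‖u w - u z‖ ≤ m * ‖w - z‖} with hE
  have huc : Continuous fun z : P => u z := continuous_iff_continuousAt.2 fun z =>
    (hu z z.2.1).continuousAt.comp continuous_subtype_val.continuousAt
  have hEc : ∀ m, IsClosed (E m) := fun m => by
    have : E m = ⋂ w ∈ Metric.ball (0 : ℂ) 1,
        ({z : P | 1 / ((m : ℝ) + 1) ≤ ‖w - z‖} ∪ {z : P | ‖u w - u z‖ ≤ m * ‖w - z‖}) := by
      ext z
      simp only [hE, Set.mem_ofPred_eq, Set.mem_iInter, Set.mem_union]
      refine forall₂_congr fun w _ => ?_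
      rw [imp_iff_not_or, not_lt]
    rw [this]
    have hn : ∀ w : ℂ, Continuous fun z : P => ‖w - z‖ := fun w =>
      (continuous_const.sub continuous_subtype_val).norm
    exact isClosed_biInter fun w _ => (isClosed_le continuous_const (hn w)).union
      (isClosed_le (continuous_const.sub huc).norm (continuous_const.mul (hn w)))
  have hEu : ⋃ m, E m = Set.univ := Set.eq_univ_of_forall fun z => by
    obtain ⟨c, hc⟩ := (hu z z.2.1).isBigO_sub.bound
    obtain ⟨ε, hε, hball⟩ := Metric.eventually_nhds_iff.1 hc
    obtain ⟨m, hm⟩ := exists_nat_gt (max c (1 / ε))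
    refine Set.mem_iUnion.2 ⟨m, fun w _ hwz => ?_⟩
    have hm1 : 1 / ((m : ℝ) + 1) < ε := by
      rw [div_lt_iff₀ (by positivity)]
      have := (le_max_right c (1 / ε)).trans_lt hm
      rw [div_lt_iff₀ hε] at this
      nlinarith
    refine (hball (by rw [dist_eq_norm]; linarith)).trans ?_
    exact mul_le_mul_of_nonneg_right ((le_max_left _ _).trans hm.le) (norm_nonneg _)
  obtain ⟨m, ⟨z, hzP⟩, hzint⟩ := nonempty_interior_of_iUnion_of_closed hEc hEu
  obtain ⟨ρ, hρ, hρball⟩ := Metric.mem_nhds_iff.1 (mem_interior_iff_mem_nhds.1 hzint)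
  obtain ⟨r₁, hr₁, hr₁ball⟩ := Metric.isOpen_iff.1 Metric.isOpen_ball z hzP.1
  set ε : ℝ := 1 / ((m : ℝ) + 1) with hε
  have hε0 : 0 < ε := by positivity
  set r := min ρ (min r₁ ε) with hr
  have hr0 : 0 < r := lt_min hρ (lt_min hr₁ hε0)
  have hrρ : r ≤ ρ := min_le_left _ _
  have hrr₁ : r ≤ r₁ := (min_le_right _ _).trans (min_le_left _ _)
  have hrε : r ≤ ε := (min_le_right _ _).trans (min_le_right _ _)
  have hin : ∀ y, dist y z < r → y ∈ Metric.ball (0 : ℂ) 1 := fun y hy =>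
    hr₁ball (by rw [Metric.mem_ball]; linarith)
  have hEm : ∀ p ∈ P, dist p z < r → ∀ w ∈ Metric.ball (0 : ℂ) 1, ‖w - p‖ < ε →
      ‖u w - u p‖ ≤ m * ‖w - p‖ := fun p hp hpz =>
    hρball (show (⟨p, hp⟩ : P) ∈ Metric.ball ⟨z, hzP⟩ ρ by
      rw [Metric.mem_ball, Subtype.dist_eq]; exact hpz.trans_le hrρ)
  refine hzP.2 ⟨max m (10 * C * m), ?_⟩
  filter_upwards [Metric.ball_mem_nhds z (show 0 < r / 4 by positivity)] with w hw
  have hwz := Metric.mem_ball.1 hw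
  have hwb : w ∈ Metric.ball (0 : ℂ) 1 := hin w (by linarith)
  by_cases hwP : w ∈ P
  · refine le_trans ?_ (le_max_left _ _)
    refine (hu w hwb).hasFDerivAt.le_of_lip' (Nat.cast_nonneg m) ?_
    filter_upwards [Metric.ball_mem_nhds w hε0, Metric.isOpen_ball.mem_nhds hwb] with y hy hyb
    exact hEm w hwP (by linarith) y hyb (by rwa [mem_ball_iff_norm] at hy)
  · refine le_trans ?_ (le_max_right _ _)
    have hwG : w ∈ Gd := by
      by_contra h
      exact hwP ⟨hwb, h⟩
    set d := Metric.infDist w P with hd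
    have hdr : d ≤ dist w z := Metric.infDist_le_dist_of_mem hzP
    have hd0 : 0 < d := by
      obtain ⟨t, ht, htG⟩ := Metric.isOpen_iff.1 hGo w hwG
      refine ht.trans_le ?_
      rw [hd, Metric.le_infDist ⟨z, hzP⟩]
      intro y hy
      by_contra! hlt
      exact hy.2 (htG (by rw [Metric.mem_ball, dist_comm]; exact hlt))
    obtain ⟨p, hp, hpw⟩ := (Metric.infDist_lt_iff (s := P) ⟨z, hzP⟩).1
      (show Metric.infDist w P < 2 * d by linarith)
    have hcl : Metric.closedBall w (d / 2) ⊆ Gd ∩ Metric.ball 0 1 := fun y hy => by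
      have hy' := Metric.mem_closedBall.1 hy
      have hyb : y ∈ Metric.ball (0 : ℂ) 1 := hin y (by linarith [dist_triangle y w z])
      refine ⟨?_, hyb⟩
      by_contra h
      have := Metric.infDist_le_dist_of_mem (x := w) (show y ∈ P from ⟨hyb, h⟩)
      rw [dist_comm] at this
      linarith
    have hup : ∀ y ∈ Metric.ball w (d / 2), ‖u y - u p‖ ≤ m * (5 * d / 2) := fun y hy => by
      have hy' := Metric.mem_ball.1 hy
      have hyp : dist y p ≤ 5 * d / 2 := by linarith [dist_triangle y w p]
      have hpz : dist p z < r := by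
        linarith [dist_triangle p w z, dist_comm p w]
      rw [dist_eq_norm] at hyp
      refine (hEm p hp hpz y (hcl (Metric.ball_subset_closedBall hy)).2 (by linarith)).trans ?_
      exact mul_le_mul_of_nonneg_left hyp (Nat.cast_nonneg m)
    have hfin := hest w (d / 2) (min (5 * m * d) ω₀) (by positivity)
      (fun y hy => (hcl (Metric.ball_subset_closedBall hy)).2)
      (by
        obtain ⟨B, hB⟩ := (isCompact_closedBall w (d / 2)).exists_bound_of_eventually_bound
          (D := fderiv ℝ u) fun y hy => (hcl hy).1
        exact ⟨B, fun y hy => hB y (Metric.ball_subset_closedBall hy)⟩)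
      (fun y hy y' hy' => le_min (by
        rw [show u y - u y' = (u y - u p) - (u y' - u p) by abel]
        refine (norm_sub_le _ _).trans ?_
        linarith [hup y hy, hup y' hy'])
        (hosc _ (hcl (Metric.ball_subset_closedBall hy)).2 _
          (hcl (Metric.ball_subset_closedBall hy')).2))
      ((min_le_right _ _).trans_lt hδ) w (Metric.mem_ball_self (by positivity))
    rw [dist_self, sub_zero] at hfin
    have h2 : ‖fderiv ℝ u w‖ * (d / 2) ≤ (10 * C * m) * (d / 2) := by
      refine hfin.trans ((mul_le_mul_of_nonneg_left (min_le_left _ _) hC).trans (le_of_eq ?_))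
      ring
    exact le_of_mul_le_mul_right h2 (by positivity)

/-- Interior gradient estimate for pseudoholomorphic discs of small diameter. -/
theorem exists_interior_gradient_estimate {V : Type} [NormedAddCommGroup V] [NormedSpace ℝ V]
    {α : ℝ} (hα : α ∈ Set.Ioo (0 : ℝ) 1) {J : V → V →L[ℝ] V} {Λ H r : ℝ}
    (hΛ : ∀ x, ‖J x‖ ≤ Λ) (hH0 : 0 ≤ H) (hH : ∀ x x', ‖J x - J x'‖ ≤ H * ‖x - x'‖ ^ α)
    (hsq : ∀ x v, J x (J x v) = -v) (hr0 : 0 < r) (hr : r < 1) :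
    ∃ δ > 0, ∃ C, 0 ≤ C ∧ ∀ (u : ℂ → V) (ω : ℝ),
      (∀ z ∈ Metric.ball (0 : ℂ) 1, DifferentiableAt ℝ u z) →
      (∀ z ∈ Metric.ball (0 : ℂ) 1, fderiv ℝ u z 1 + J (u z) (fderiv ℝ u z Complex.I) = 0) →
      (∀ z ∈ Metric.ball (0 : ℂ) 1, ∀ z' ∈ Metric.ball (0 : ℂ) 1, ‖u z - u z'‖ ≤ ω) → ω < δ →
      ∀ z ∈ Metric.ball (0 : ℂ) r, ‖fderiv ℝ u z‖ ≤ C * ω := by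
  obtain ⟨δ, hδ, C, hC, hest⟩ := exists_gradient_estimate hα hΛ hH0 hH hsq
  refine ⟨δ, hδ, C * (2 / (1 - r)), ?_, fun u ω hu hJ hω hωδ z hz => ?_⟩
  · have : 0 < 1 - r := by linarith
    positivity
  have hloc := eventually_norm_fderiv_le hC hu hω hωδ fun z₁ R ω' hR hsub hb ho hlt =>
    hest u z₁ R ω' hR (fun z hz => hu z (hsub hz)) hb (fun z hz => hJ z (hsub hz)) ho hlt
  have hsub : Metric.closedBall (0 : ℂ) ((1 + r) / 2) ⊆ Metric.ball 0 1 :=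
    Metric.closedBall_subset_ball (by linarith)
  have hsub' := Metric.ball_subset_closedBall.trans hsub
  obtain ⟨B, hB⟩ := (isCompact_closedBall (0 : ℂ) ((1 + r) / 2)).exists_bound_of_eventually_bound
    (D := fderiv ℝ u) fun y hy => hloc y (hsub hy)
  have hz' := Metric.mem_ball.1 hz
  have h1 := hest u 0 ((1 + r) / 2) ω (by linarith) (fun y hy => hu y (hsub' hy))
    ⟨B, fun y hy => hB y (Metric.ball_subset_closedBall hy)⟩ (fun y hy => hJ y (hsub' hy))
    (fun y hy y' hy' => hω y (hsub' hy) y' (hsub' hy')) hωδ z (by rw [Metric.mem_ball]; linarith)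
  have h2 : (1 - r) / 2 ≤ (1 + r) / 2 - dist z 0 := by linarith
  have h3 := mul_le_mul_of_nonneg_left h2 (norm_nonneg (fderiv ℝ u z))
  have h4 : 0 < 1 - r := by linarith
  rw [show C * (2 / (1 - r)) * ω = (2 * (C * ω)) / (1 - r) by ring, le_div_iff₀ h4]
  linarith

/-- `w` and its derivatives up to order `k` are bounded by `K` on `U`, and the `k`-th derivative is
`α`-Hölder on `U` with constant `K`. -/
def HolderBdd {X : Type} [NormedAddCommGroup X] [NormedSpace ℝ X] (α : ℝ) (U : Set X) :
    ℕ → ∀ {V : Type} [NormedAddCommGroup V] [NormedSpace ℝ V], (X → V) → ℝ → Prop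
  | 0, _, _, _, w, K => (∀ x ∈ U, ‖w x‖ ≤ K) ∧
      ∀ x ∈ U, ∀ y ∈ U, ‖w x - w y‖ ≤ K * ‖x - y‖ ^ α
  | k + 1, _, _, _, w, K => (∀ x ∈ U, ‖w x‖ ≤ K) ∧ (∀ x ∈ U, DifferentiableAt ℝ w x) ∧
      HolderBdd α U k (fderiv ℝ w) K

namespace HolderBdd

variable {X : Type} [NormedAddCommGroup X] [NormedSpace ℝ X] {α : ℝ} {U : Set X} {k : ℕ}

theorem bound {V : Type} [NormedAddCommGroup V] [NormedSpace ℝ V] {w : X → V} {K : ℝ}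
    (h : HolderBdd α U k w K) : ∀ x ∈ U, ‖w x‖ ≤ K := by
  cases k with
  | zero => exact h.1
  | succ k => exact h.1

theorem mono {V : Type} [NormedAddCommGroup V] [NormedSpace ℝ V] {w : X → V} {K K' : ℝ}
    {U' : Set X} (h : HolderBdd α U k w K) (hK : K ≤ K') (hU : U' ⊆ U) :
    HolderBdd α U' k w K' := by
  induction k generalizing V with
  | zero =>
    exact ⟨fun x hx => (h.1 x (hU hx)).trans hK, fun x hx y hy =>
      (h.2 x (hU hx) y (hU hy)).trans (mul_le_mul_of_nonneg_right hK (by positivity))⟩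
  | succ k ih =>
    exact ⟨fun x hx => (h.1 x (hU hx)).trans hK, fun x hx => h.2.1 x (hU hx), ih h.2.2⟩

theorem congr {V : Type} [NormedAddCommGroup V] [NormedSpace ℝ V] {w w' : X → V} {K : ℝ}
    (h : HolderBdd α U k w K) (hU : IsOpen U) (hw : ∀ x ∈ U, w' x = w x) :
    HolderBdd α U k w' K := by
  induction k generalizing V with
  | zero =>
    refine ⟨fun x hx => ?_, fun x hx y hy => ?_⟩
    · rw [hw x hx]; exact h.1 x hx
    · rw [hw x hx, hw y hy]; exact h.2 x hx y hy
  | succ k ih =>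
    have hev : ∀ x ∈ U, w' =ᶠ[nhds x] w := fun x hx =>
      Filter.eventuallyEq_of_mem (hU.mem_nhds hx) hw
    refine ⟨fun x hx => ?_, fun x hx => ?_, ih h.2.2 fun x hx => (hev x hx).fderiv_eq⟩
    · rw [hw x hx]; exact h.1 x hx
    · exact (h.2.1 x hx).congr_of_eventuallyEq (hev x hx)

theorem of_lipschitz {V : Type} [NormedAddCommGroup V] [NormedSpace ℝ V] {w : X → V} {K L : ℝ}
    (hα : α ∈ Set.Ioo (0 : ℝ) 1) (h : ∀ x ∈ U, ‖w x‖ ≤ K)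
    (hL : ∀ x ∈ U, ∀ y ∈ U, ‖w x - w y‖ ≤ L * ‖x - y‖) :
    HolderBdd α U 0 w (2 * K + |L|) := by
  refine ⟨fun x hx => ?_, fun x hx y hy => ?_⟩
  · linarith [h x hx, (norm_nonneg _).trans (h x hx), abs_nonneg L]
  · have hK := (norm_nonneg _).trans (h x hx)
    rcases le_total ‖x - y‖ 1 with h1 | h1
    · have h2 : ‖x - y‖ ≤ ‖x - y‖ ^ α := by
        calc ‖x - y‖ = ‖x - y‖ ^ (1 : ℝ) := (Real.rpow_one _).symm
          _ ≤ _ := Real.rpow_le_rpow_of_exponent_ge' (norm_nonneg _) h1 hα.1.le hα.2.le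
      calc _ ≤ L * ‖x - y‖ := hL x hx y hy
        _ ≤ |L| * ‖x - y‖ := mul_le_mul_of_nonneg_right (le_abs_self L) (norm_nonneg _)
        _ ≤ (2 * K + |L|) * ‖x - y‖ ^ α :=
          mul_le_mul (by linarith) h2 (norm_nonneg _) (by positivity)
    · have h2 : 1 ≤ ‖x - y‖ ^ α := Real.one_le_rpow h1 hα.1.le
      calc _ ≤ K + K := (norm_sub_le _ _).trans (add_le_add (h x hx) (h y hy))
        _ ≤ (2 * K + |L|) * 1 := by linarith [abs_nonneg L]
        _ ≤ _ := mul_le_mul_of_nonneg_left h2 (by positivity)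

theorem lipschitz {V : Type} [NormedAddCommGroup V] [NormedSpace ℝ V] {w : X → V} {K : ℝ}
    (h : HolderBdd α U (k + 1) w K) (hU : Convex ℝ U) :
    ∀ x ∈ U, ∀ y ∈ U, ‖w x - w y‖ ≤ K * ‖x - y‖ := fun _ hx _ hy =>
  hU.norm_image_sub_le_of_norm_fderiv_le h.2.1 h.2.2.bound hy hx

theorem of_succ {V : Type} [NormedAddCommGroup V] [NormedSpace ℝ V] {w : X → V} {K : ℝ}
    (h : HolderBdd α U (k + 1) w K) (hα : α ∈ Set.Ioo (0 : ℝ) 1) (hU : Convex ℝ U) (hK : 0 ≤ K) :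
    HolderBdd α U k w (3 * K) := by
  induction k generalizing V with
  | zero =>
    refine (of_lipschitz hα h.bound (h.lipschitz hU)).mono ?_ subset_rfl
    rw [abs_of_nonneg hK]; linarith
  | succ k ih => exact ⟨fun x hx => (h.1 x hx).trans (by linarith), h.2.1, ih h.2.2⟩

theorem add {V : Type} [NormedAddCommGroup V] [NormedSpace ℝ V] {w w' : X → V} {K K' : ℝ}
    (h : HolderBdd α U k w K) (h' : HolderBdd α U k w' K') (hU : IsOpen U) :
    HolderBdd α U k (fun x => w x + w' x) (K + K') := by
  induction k generalizing V with
  | zero =>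
    refine ⟨fun x hx => (norm_add_le _ _).trans (add_le_add (h.1 x hx) (h'.1 x hx)),
      fun x hx y hy => ?_⟩
    rw [add_sub_add_comm, add_mul]
    exact (norm_add_le _ _).trans (add_le_add (h.2 x hx y hy) (h'.2 x hx y hy))
  | succ k ih =>
    refine ⟨fun x hx => (norm_add_le _ _).trans (add_le_add (h.1 x hx) (h'.1 x hx)),
      fun x hx => (h.2.1 x hx).add (h'.2.1 x hx), (ih h.2.2 h'.2.2).congr hU fun x hx => ?_⟩
    exact ((h.2.1 x hx).hasFDerivAt.add (h'.2.1 x hx).hasFDerivAt).fderiv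

theorem clm_comp {V W : Type} [NormedAddCommGroup V] [NormedSpace ℝ V] [NormedAddCommGroup W]
    [NormedSpace ℝ W] {w : X → V} {K M : ℝ} (h : HolderBdd α U k w K) (hU : IsOpen U)
    (A : V →L[ℝ] W) (hA : ‖A‖ ≤ M) : HolderBdd α U k (fun x => A (w x)) (M * K) := by
  have hM : 0 ≤ M := (norm_nonneg _).trans hA
  have hb : ∀ {V W : Type} [NormedAddCommGroup V] [NormedSpace ℝ V] [NormedAddCommGroup W]
      [NormedSpace ℝ W] (A : V →L[ℝ] W) (v : V) (K : ℝ), ‖A‖ ≤ M → ‖v‖ ≤ K → ‖A v‖ ≤ M * K :=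
    fun A v K hA hv => (A.le_opNorm v).trans (mul_le_mul hA hv (norm_nonneg _) hM)
  induction k generalizing V W with
  | zero =>
    refine ⟨fun x hx => hb A _ _ hA (h.1 x hx), fun x hx y hy => ?_⟩
    rw [← map_sub, mul_assoc]
    exact hb A _ _ hA (h.2 x hx y hy)
  | succ k ih =>
    have hd : ∀ x ∈ U, HasFDerivAt (fun x => A (w x)) (A.comp (fderiv ℝ w x)) x := fun x hx =>
      A.hasFDerivAt.comp x (h.2.1 x hx).hasFDerivAt
    refine ⟨fun x hx => hb A _ _ hA (h.1 x hx), fun x hx => (hd x hx).differentiableAt, ?_⟩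
    refine (ih h.2.2 (ContinuousLinearMap.compL ℝ X V W A) ?_).congr hU fun x hx => (hd x hx).fderiv
    refine ContinuousLinearMap.opNorm_le_bound _ hM fun T => ?_
    exact (ContinuousLinearMap.opNorm_comp_le A T).trans
      (mul_le_mul_of_nonneg_right hA (norm_nonneg _))

theorem bilin {V W Z : Type} [NormedAddCommGroup V] [NormedSpace ℝ V] [NormedAddCommGroup W]
    [NormedSpace ℝ W] [NormedAddCommGroup Z] [NormedSpace ℝ Z] {w : X → V} {w' : X → W}
    {K K' M : ℝ} (h : HolderBdd α U k w K) (h' : HolderBdd α U k w' K') (hU : IsOpen U)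
    (hUc : Convex ℝ U) (hα : α ∈ Set.Ioo (0 : ℝ) 1) (hK : 0 ≤ K) (hK' : 0 ≤ K')
    (B : V →L[ℝ] W →L[ℝ] Z) (hB : ‖B‖ ≤ M) :
    HolderBdd α U k (fun x => B (w x) (w' x)) (2 * 6 ^ k * M * K * K') := by
  have hM : 0 ≤ M := (norm_nonneg B).trans hB
  have hb : ∀ {V W Z : Type} [NormedAddCommGroup V] [NormedSpace ℝ V] [NormedAddCommGroup W]
      [NormedSpace ℝ W] [NormedAddCommGroup Z] [NormedSpace ℝ Z]
      (B : V →L[ℝ] W →L[ℝ] Z) (v : V) (w : W) (a b : ℝ), ‖B‖ ≤ M → ‖v‖ ≤ a → ‖w‖ ≤ b →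
      0 ≤ a → ‖B v w‖ ≤ M * a * b := fun B v w a b hB hv hw ha =>
    (B.le_opNorm₂ v w).trans (mul_le_mul (mul_le_mul hB hv (norm_nonneg _) hM) hw (norm_nonneg _)
      (by positivity))
  have hbd : ∀ n : ℕ, ∀ x ∈ U, ‖B (w x) (w' x)‖ ≤ 2 * 6 ^ n * M * K * K' := fun n x hx => by
    refine (hb B _ _ _ _ hB (h.bound x hx) (h'.bound x hx) hK).trans ?_
    rw [show 2 * 6 ^ n * M * K * K' = 2 * 6 ^ n * (M * K * K') by ring]
    refine le_mul_of_one_le_left (by positivity) ?_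
    have : (1 : ℝ) ≤ 6 ^ n := one_le_pow₀ (by norm_num)
    linarith
  induction k generalizing V W Z K K' with
  | zero =>
    refine ⟨hbd 0, fun x hx y hy => ?_⟩
    have heq : B (w x) (w' x) - B (w y) (w' y) =
        B (w x - w y) (w' x) + B (w y) (w' x - w' y) := by
      simp only [map_sub, sub_apply]; abel
    rw [heq]
    have e1 := hb B _ _ _ _ hB (h.2 x hx y hy) (h'.1 x hx) (by positivity)
    have e2 := hb B _ _ _ _ hB (h.1 y hy) (h'.2 x hx y hy) hK
    refine (norm_add_le _ _).trans ((add_le_add e1 e2).trans (le_of_eq ?_))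
    ring
  | succ k ih =>
    have hd : ∀ x ∈ U, HasFDerivAt (fun x => B (w x) (w' x))
        (B.precompR X (w x) (fderiv ℝ w' x) + B.precompL X (fderiv ℝ w x) (w' x)) x := fun x hx =>
      B.hasFDerivAt_of_bilinear (h.2.1 x hx).hasFDerivAt (h'.2.1 x hx).hasFDerivAt
    refine ⟨hbd _, fun x hx => (hd x hx).differentiableAt, ?_⟩
    have aux : ∀ {V W Z : Type} [NormedAddCommGroup V] [NormedSpace ℝ V] [NormedAddCommGroup W]
        [NormedSpace ℝ W] [NormedAddCommGroup Z] [NormedSpace ℝ Z] {w : X → V} {w' : X → W}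
        {K K' : ℝ}, HolderBdd α U k w K → HolderBdd α U k w' K' → 0 ≤ K → 0 ≤ K' →
        ∀ (B : V →L[ℝ] W →L[ℝ] Z), ‖B‖ ≤ M →
        HolderBdd α U k (fun x => B (w x) (w' x)) (2 * 6 ^ k * M * K * K') := by
      intro V W Z _ _ _ _ _ _ w w' K K' h h' hK hK' B hB
      refine ih h h' hK hK' B hB fun n x hx => ?_
      refine (hb B _ _ _ _ hB (h.bound x hx) (h'.bound x hx) hK).trans ?_
      rw [show 2 * 6 ^ n * M * K * K' = 2 * 6 ^ n * (M * K * K') by ring]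
      refine le_mul_of_one_le_left (by positivity) ?_
      have : (1 : ℝ) ≤ 6 ^ n := one_le_pow₀ (by norm_num)
      linarith
    have e1 := aux (h.of_succ hα hUc hK) h'.2.2 (by positivity) hK' (B.precompR X)
      ((B.norm_precompR_le X).trans hB)
    have e2 := aux h.2.2 (h'.of_succ hα hUc hK') hK (by positivity) (B.precompL X)
      ((B.norm_precompL_le X).trans hB)
    refine ((e1.add e2 hU).congr hU fun x hx => (hd x hx).fderiv).mono (le_of_eq ?_) subset_rfl
    ring

/-- Composition of a globally Hölder map with a Hölder map having bounded differential. -/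
theorem exists_comp (hα : α ∈ Set.Ioo (0 : ℝ) 1) (k : ℕ) (M K : ℝ) (hM : 0 ≤ M) (hK : 0 ≤ K) :
    ∃ C, 0 ≤ C ∧ ∀ {Y V : Type} [NormedAddCommGroup Y] [NormedSpace ℝ Y] [NormedAddCommGroup V]
      [NormedSpace ℝ V] (J : Y → V) (u : X → Y), IsOpen U → Convex ℝ U →
      HolderBdd α Set.univ k J M → HolderBdd α U k u K → (∀ x ∈ U, DifferentiableAt ℝ u x) →
      (∀ x ∈ U, ‖fderiv ℝ u x‖ ≤ K) → HolderBdd α U k (fun x => J (u x)) C := by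
  induction k generalizing K with
  | zero =>
    refine ⟨M + M * K ^ α, by positivity, fun J u hU hUc hJ hu hd hb => ⟨fun x _ => ?_,
      fun x hx y hy => ?_⟩⟩
    · exact (hJ.1 _ trivial).trans (le_add_of_nonneg_right (by positivity))
    · have hl : ‖u x - u y‖ ≤ K * ‖x - y‖ :=
        hUc.norm_image_sub_le_of_norm_fderiv_le hd hb hy hx
      calc _ ≤ M * ‖u x - u y‖ ^ α := hJ.2 _ trivial _ trivial
        _ ≤ M * (K * ‖x - y‖) ^ α :=
          mul_le_mul_of_nonneg_left (Real.rpow_le_rpow (norm_nonneg _) hl hα.1.le) hM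
        _ = M * K ^ α * ‖x - y‖ ^ α := by rw [Real.mul_rpow hK (norm_nonneg _), mul_assoc]
        _ ≤ _ := mul_le_mul_of_nonneg_right (le_add_of_nonneg_left hM) (by positivity)
  | succ k ih =>
    obtain ⟨C, hC, hcomp⟩ := ih (3 * K) (by positivity)
    refine ⟨M + 2 * 6 ^ k * 1 * C * K, by positivity, fun {Y V} _ _ _ _ J u hU hUc hJ hu hd hb => ?_⟩
    have hd' : ∀ x ∈ U, HasFDerivAt (fun x => J (u x)) ((fderiv ℝ J (u x)).comp (fderiv ℝ u x)) x :=
      fun x hx => (hJ.2.1 _ trivial).hasFDerivAt.comp x (hd x hx).hasFDerivAt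
    refine ⟨fun x hx => (hJ.1 _ trivial).trans (le_add_of_nonneg_right (by positivity)),
      fun x hx => (hd' x hx).differentiableAt, ?_⟩
    have h1 := hcomp (fderiv ℝ J) u hU hUc hJ.2.2 (hu.of_succ hα hUc hK) hd
      (fun x hx => (hb x hx).trans (by linarith))
    have h2 := h1.bilin hu.2.2 hU hUc hα hC hK (ContinuousLinearMap.compL ℝ X Y V)
      (ContinuousLinearMap.norm_compL_le ℝ X Y V)
    exact (h2.congr hU fun x hx => (hd' x hx).fderiv).mono (le_add_of_nonneg_left hM) subset_rfl

theorem norm_iteratedFDeriv_succ_sub {V : Type} [NormedAddCommGroup V] [NormedSpace ℝ V]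
    (w : X → V) (j : ℕ) (x y : X) :
    ‖iteratedFDeriv ℝ (j + 1) w x - iteratedFDeriv ℝ (j + 1) w y‖ =
      ‖iteratedFDeriv ℝ j (fderiv ℝ w) x - iteratedFDeriv ℝ j (fderiv ℝ w) y‖ := by
  simp only [← dist_eq_norm, iteratedFDeriv_succ_eq_comp_right, Function.comp_apply]
  exact (continuousMultilinearCurryRightEquiv' ℝ j X V).symm.dist_map _ _

theorem norm_iteratedFDeriv_zero_sub {V : Type} [NormedAddCommGroup V] [NormedSpace ℝ V]
    (w : X → V) (x y : X) :
    ‖iteratedFDeriv ℝ 0 w x - iteratedFDeriv ℝ 0 w y‖ = ‖w x - w y‖ := by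
  rw [iteratedFDeriv_zero_eq_comp, Function.comp_apply, Function.comp_apply, ← map_sub,
    LinearIsometryEquiv.norm_map]

theorem of_contDiff {V : Type} [NormedAddCommGroup V] [NormedSpace ℝ V] {w : X → V} {K : ℝ}
    (hw : ContDiff ℝ (k : ℕ∞) w) (hK : ∀ j ≤ k, ∀ x, ‖iteratedFDeriv ℝ j w x‖ ≤ K)
    (hH : ∀ x y, ‖iteratedFDeriv ℝ k w x - iteratedFDeriv ℝ k w y‖ ≤ K * ‖x - y‖ ^ α) :
    HolderBdd α Set.univ k w K := by
  induction k generalizing V with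
  | zero =>
    refine ⟨fun x _ => ?_, fun x _ y _ => ?_⟩
    · simpa using hK 0 le_rfl x
    · rw [← norm_iteratedFDeriv_zero_sub]; exact hH x y
  | succ k ih =>
    refine ⟨fun x _ => by simpa using hK 0 (Nat.zero_le _) x, fun x _ =>
      hw.differentiable (by simp) x, ih ?_ (fun j hj x => ?_) fun x y => ?_⟩
    · exact hw.fderiv_right (by norm_cast)
    · rw [norm_iteratedFDeriv_fderiv]; exact hK _ (by omega) x
    · rw [← norm_iteratedFDeriv_succ_sub]; exact hH x y

theorem contDiffOn {V : Type} [NormedAddCommGroup V] [NormedSpace ℝ V] {w : X → V} {K : ℝ}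
    (h : HolderBdd α U k w K) (hU : IsOpen U) (hα : 0 < α) : ContDiffOn ℝ (k : ℕ∞) w U := by
  induction k generalizing V with
  | zero =>
    rw [Nat.cast_zero, WithTop.coe_zero, contDiffOn_zero]
    intro x hx
    refine tendsto_iff_norm_sub_tendsto_zero.2 ?_
    have hcont : Filter.Tendsto (fun y => K * ‖y - x‖ ^ α) (nhdsWithin x U)
        (nhds (K * ‖x - x‖ ^ α)) := by
      have : Continuous fun y => K * ‖y - x‖ ^ α :=
        continuous_const.mul ((continuous_id.sub continuous_const).norm.rpow_const
          fun _ => Or.inr hα.le)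
      exact this.continuousWithinAt
    rw [sub_self, norm_zero, Real.zero_rpow hα.ne', mul_zero] at hcont
    refine squeeze_zero' (Filter.Eventually.of_forall fun _ => norm_nonneg _) ?_ hcont
    filter_upwards [self_mem_nhdsWithin] with y hy
    exact h.2 y hy x hx
  | succ k ih =>
    have := (contDiffOn_succ_iff_fderiv_of_isOpen (𝕜 := ℝ) (f := w) (n := ((k : ℕ∞) : WithTop ℕ∞))
      hU).2 ⟨fun x hx => (h.2.1 x hx).differentiableWithinAt, by simp, ih h.2.2⟩
    exact_mod_cast this

theorem norm_iteratedFDeriv_le {V : Type} [NormedAddCommGroup V] [NormedSpace ℝ V] {w : X → V}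
    {K : ℝ} (h : HolderBdd α U k w K) {j : ℕ} (hj : j ≤ k) :
    ∀ x ∈ U, ‖iteratedFDeriv ℝ j w x‖ ≤ K := by
  intro x hx
  induction j generalizing V k with
  | zero => simpa using h.bound x hx
  | succ j ih =>
    obtain ⟨k, rfl⟩ : ∃ m, k = m + 1 := ⟨k - 1, by omega⟩
    rw [← norm_iteratedFDeriv_fderiv]
    exact ih h.2.2 (by omega)

theorem norm_iteratedFDeriv_sub_le {V : Type} [NormedAddCommGroup V] [NormedSpace ℝ V] {w : X → V}
    {K : ℝ} (h : HolderBdd α U k w K) :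
    ∀ x ∈ U, ∀ y ∈ U, ‖iteratedFDeriv ℝ k w x - iteratedFDeriv ℝ k w y‖ ≤ K * ‖x - y‖ ^ α := by
  intro x hx y hy
  induction k generalizing V with
  | zero => rw [norm_iteratedFDeriv_zero_sub]; exact h.2 x hx y hy
  | succ k ih => rw [norm_iteratedFDeriv_succ_sub]; exact ih h.2.2

end HolderBdd

/-- Difference quotients of a `C^{1,α}` map are `C^{0,α}`, uniformly in the step. -/
theorem HolderBdd.slope {X V : Type} [NormedAddCommGroup X] [NormedSpace ℝ X]
    [NormedAddCommGroup V] [NormedSpace ℝ V] {α : ℝ} {U U' : Set X} {F : X → V} {N t : ℝ} {e : X}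
    (h : HolderBdd α U 1 F N) (hU : Convex ℝ U) (ht : 0 < t) (he : ‖e‖ = 1) (hU' : U' ⊆ U)
    (hte : ∀ z ∈ U', z + t • e ∈ U) :
    HolderBdd α U' 0 (fun z => t⁻¹ • (F (z + t • e) - F z)) N := by
  have hnorm : ‖t • e‖ = t := by rw [norm_smul, he, mul_one, Real.norm_of_nonneg ht.le]
  have hscale : ∀ (x : V) (K : ℝ), ‖x‖ ≤ K * t → ‖t⁻¹ • x‖ ≤ K := fun x K hx => by
    rw [norm_smul, norm_inv, Real.norm_of_nonneg ht.le, inv_mul_le_iff₀ ht]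
    linarith
  refine ⟨fun z hz => hscale _ _ ?_, fun z hz z' hz' => ?_⟩
  · have := HolderBdd.lipschitz h hU _ (hte z hz) _ (hU' hz)
    rwa [add_sub_cancel_left, hnorm] at this
  · rw [← smul_sub]
    refine hscale _ _ ?_
    set d := z' - z with hd
    have hS : Convex ℝ (U ∩ (fun y => y + d) ⁻¹' U) :=
      hU.inter (hU.translate_preimage_left d)
    have hder : ∀ y ∈ U ∩ (fun y => y + d) ⁻¹' U,
        HasFDerivAt (fun y => F y - F (y + d)) (fderiv ℝ F y - fderiv ℝ F (y + d)) y :=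
      fun y hy => (h.2.1 y hy.1).hasFDerivAt.sub
        ((hasFDerivAt_comp_add_right d).2 (h.2.1 (y + d) hy.2).hasFDerivAt)
    have hz1 : z ∈ U ∩ (fun y => y + d) ⁻¹' U := ⟨hU' hz, by
      simpa [hd] using hU' hz'⟩
    have hz2 : z + t • e ∈ U ∩ (fun y => y + d) ⁻¹' U := ⟨hte z hz, by
      have : z + t • e + d = z' + t • e := by rw [hd]; abel
      simpa only [Set.mem_preimage, this] using hte z' hz'⟩
    have key := hS.norm_image_sub_le_of_norm_hasFDerivWithin_le
      (C := N * ‖z - z'‖ ^ α) (fun y hy => (hder y hy).hasFDerivWithinAt) (fun y hy => by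
        have := h.2.2.2 y hy.1 (y + d) hy.2
        rwa [sub_add_cancel_left, norm_neg, hd, norm_sub_rev z' z] at this) hz1 hz2
    rw [add_sub_cancel_left, hnorm] at key
    refine le_trans (le_of_eq ?_) key
    congr 1
    rw [show z + t • e + d = z' + t • e by rw [hd]; abel, show z + d = z' by rw [hd]; abel]
    abel

/-- Pointwise limits of maps with uniformly Hölder differentials are differentiable. -/
theorem exists_hasFDerivAt_of_tendsto {X V : Type*} [NormedAddCommGroup X] [NormedSpace ℝ X]
    [FiniteDimensional ℝ X] [NormedAddCommGroup V] [NormedSpace ℝ V] [FiniteDimensional ℝ V]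
    {α K : ℝ} (hα : 0 < α) {U : Set X} (hU : IsOpen U) (hUc : Convex ℝ U) {w : ℕ → X → V}
    {g : X → V} (hd : ∀ n, ∀ y ∈ U, DifferentiableAt ℝ (w n) y)
    (hb : ∀ n, ∀ y ∈ U, ‖fderiv ℝ (w n) y‖ ≤ K)
    (hh : ∀ n, ∀ y ∈ U, ∀ y' ∈ U, ‖fderiv ℝ (w n) y - fderiv ℝ (w n) y'‖ ≤ K * ‖y - y'‖ ^ α)
    (hlim : ∀ y ∈ U, Filter.Tendsto (fun n => w n y) Filter.atTop (nhds (g y)))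
    {x : X} (hx : x ∈ U) : ∃ P : X →L[ℝ] V, ‖P‖ ≤ K ∧ HasFDerivAt g P x := by
  have : ProperSpace (X →L[ℝ] V) := FiniteDimensional.proper ℝ _
  have hK : 0 ≤ K := (norm_nonneg _).trans (hb 0 x hx)
  obtain ⟨P, hP, φ, hφ, hφP⟩ := (isCompact_closedBall (0 : X →L[ℝ] V) K).tendsto_subseq
    (x := fun n => fderiv ℝ (w n) x) fun n => mem_closedBall_zero_iff.2 (hb n x hx)
  refine ⟨P, mem_closedBall_zero_iff.1 hP, hasFDerivAt_of_norm_sub_le_rpow (K := K) hα ?_⟩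
  filter_upwards [hU.mem_nhds hx] with y hy
  have hl : Filter.Tendsto (fun n => ‖w (φ n) y - w (φ n) x - fderiv ℝ (w (φ n)) x (y - x)‖)
      Filter.atTop (nhds ‖g y - g x - P (y - x)‖) := by
    refine Filter.Tendsto.norm (Filter.Tendsto.sub (Filter.Tendsto.sub
      ((hlim y hy).comp hφ.tendsto_atTop) ((hlim x hx).comp hφ.tendsto_atTop)) ?_)
    exact ((ContinuousLinearMap.apply ℝ V (y - x)).continuous.tendsto P).comp hφP
  refine le_of_tendsto hl (Filter.Eventually.of_forall fun n => ?_)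
  have hS : Convex ℝ (U ∩ Metric.closedBall x ‖y - x‖) := hUc.inter (convex_closedBall _ _)
  have hyS : y ∈ U ∩ Metric.closedBall x ‖y - x‖ :=
    ⟨hy, by rw [Metric.mem_closedBall, dist_eq_norm]⟩
  have hxS : x ∈ U ∩ Metric.closedBall x ‖y - x‖ :=
    ⟨hx, Metric.mem_closedBall_self (norm_nonneg _)⟩
  have key := hS.norm_image_sub_le_of_norm_fderiv_le' (𝕜 := ℝ) (f := w (φ n))
    (φ := fderiv ℝ (w (φ n)) x) (C := K * ‖y - x‖ ^ α) (fun z hz => hd _ z hz.1)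
    (fun z hz => (hh _ z hz.1 x hx).trans (mul_le_mul_of_nonneg_left
      (Real.rpow_le_rpow (norm_nonneg _) (by
        rw [← dist_eq_norm]; exact hz.2) hα.le) hK)) hxS hyS
  refine key.trans (le_of_eq ?_)
  rcases eq_or_ne (‖y - x‖) 0 with h0 | h0
  · rw [h0, mul_zero, Real.zero_rpow (by linarith), mul_zero]
  · rw [Real.rpow_add ((norm_nonneg _).lt_of_ne' h0), Real.rpow_one]; ring

/-- Solutions of a linear Cauchy–Riemann type equation with `C^{1,α}` data have a
differentiable gradient. -/
theorem exists_bound_fderiv_fderiv_apply {V : Type} [NormedAddCommGroup V] [NormedSpace ℝ V]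
    [FiniteDimensional ℝ V] {α : ℝ} (hα : α ∈ Set.Ioo (0 : ℝ) 1) {Λ N r' r : ℝ} (hΛ : 0 ≤ Λ)
    (hN : 0 ≤ N) (hr : r' < r) {a : ℂ → V →L[ℝ] V} {v f : ℂ → V}
    (hv : ∀ z ∈ Metric.ball (0 : ℂ) r, DifferentiableAt ℝ v z)
    (hvb : ∃ B, ∀ z ∈ Metric.ball (0 : ℂ) r, ‖fderiv ℝ v z‖ ≤ B)
    (heq : ∀ z ∈ Metric.ball (0 : ℂ) r, fderiv ℝ v z 1 + a z (fderiv ℝ v z Complex.I) = f z)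
    (hsq : ∀ z x, a z (a z x) = -x)
    (ha : HolderBdd α (Metric.ball (0 : ℂ) r) 1 a Λ) (hvN : ∀ z ∈ Metric.ball (0 : ℂ) r, ‖v z‖ ≤ N)
    (hf : HolderBdd α (Metric.ball (0 : ℂ) r) 1 f N) {e : ℂ} (he : ‖e‖ = 1) :
    ∃ B, ∀ z ∈ Metric.ball (0 : ℂ) r', DifferentiableAt ℝ (fun z => fderiv ℝ v z e) z ∧
      ‖fderiv ℝ (fun z => fderiv ℝ v z e) z‖ ≤ B := by
  set ε := (r - r') / 4 with hε
  have hε0 : 0 < ε := by rw [hε]; linarith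
  have hrε : r = r' + 4 * ε := by rw [hε]; ring
  have ha0 := HolderBdd.of_succ ha hα (convex_ball _ _) hΛ
  have hf0 := HolderBdd.of_succ hf hα (convex_ball _ _) hN
  obtain ⟨C, hC, hest⟩ := exists_linear_estimate (V := V) hα (Λ := 3 * Λ) (r' := r' + 3 * ε) (r := r)
    (by positivity) (by linarith)
  obtain ⟨hD1, hD2⟩ := hest a v f (3 * N) hv hvb heq hsq ha0.1 ha0.2
    (fun z hz => (hvN z hz).trans (by linarith)) hf0.1 hf0.2
  obtain ⟨C', hC', hest'⟩ := exists_linear_estimate (V := V) hα (Λ := 3 * Λ) (r' := r')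
    (r := r' + 2 * ε) (by positivity) (by linarith)
  have hball : ∀ z ∈ Metric.ball (0 : ℂ) (r' + 2 * ε), ∀ t : ℝ, 0 < t → t ≤ ε →
      z + t • e ∈ Metric.ball (0 : ℂ) (r' + 3 * ε) := fun z hz t ht htε => by
    rw [mem_ball_zero_iff] at hz ⊢
    have : ‖t • e‖ = t := by rw [norm_smul, he, mul_one, Real.norm_of_nonneg ht.le]
    linarith [norm_add_le z (t • e)]
  have hsub1 : Metric.ball (0 : ℂ) (r' + 3 * ε) ⊆ Metric.ball 0 r :=
    Metric.ball_subset_ball (by linarith)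
  have hsub2 : Metric.ball (0 : ℂ) (r' + 2 * ε) ⊆ Metric.ball 0 (r' + 3 * ε) :=
    Metric.ball_subset_ball (by linarith)
  have hsub3 : Metric.ball (0 : ℂ) r' ⊆ Metric.ball 0 (r' + 2 * ε) :=
    Metric.ball_subset_ball (by linarith)
  set G := C * (3 * N) with hG
  have hG0 : 0 ≤ G := by positivity
  have hvG : HolderBdd α (Metric.ball (0 : ℂ) (r' + 3 * ε)) 1 v (N + G) := by
    refine ⟨fun z hz => (hvN z (hsub1 hz)).trans (by linarith), fun z hz => hv z (hsub1 hz),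
      fun z hz => (hD1 z hz).trans (by linarith), fun z hz z' hz' => (hD2 z hz z' hz').trans ?_⟩
    exact mul_le_mul_of_nonneg_right (by linarith) (by positivity)
  set L := N + 2 * 6 ^ 0 * 1 * Λ * G + (N + G) with hL
  -- the difference quotients solve equations of the same type
  have hquot : ∀ t : ℝ, 0 < t → t ≤ ε →
      (∀ z ∈ Metric.ball (0 : ℂ) (r' + 2 * ε), HasFDerivAt (fun z => t⁻¹ • (v (z + t • e) - v z))
        (t⁻¹ • (fderiv ℝ v (z + t • e) - fderiv ℝ v z)) z) ∧
      (∀ z ∈ Metric.ball (0 : ℂ) r', ‖fderiv ℝ (fun z => t⁻¹ • (v (z + t • e) - v z)) z‖ ≤ C' * L) ∧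
      ∀ z ∈ Metric.ball (0 : ℂ) r', ∀ z' ∈ Metric.ball (0 : ℂ) r',
        ‖fderiv ℝ (fun z => t⁻¹ • (v (z + t • e) - v z)) z -
          fderiv ℝ (fun z => t⁻¹ • (v (z + t • e) - v z)) z'‖ ≤ C' * L * ‖z - z'‖ ^ α := by
    intro t ht htε
    have hder : ∀ z ∈ Metric.ball (0 : ℂ) (r' + 2 * ε),
        HasFDerivAt (fun z => t⁻¹ • (v (z + t • e) - v z))
        (t⁻¹ • (fderiv ℝ v (z + t • e) - fderiv ℝ v z)) z := fun z hz =>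
      (((hasFDerivAt_comp_add_right (t • e)).2 (hvG.2.1 _ (hball z hz t ht htε)).hasFDerivAt).sub
        (hvG.2.1 z (hsub2 hz)).hasFDerivAt).const_smul t⁻¹
    have hvs := hvG.slope (convex_ball _ _) ht he hsub2 fun z hz => hball z hz t ht htε
    have hfs := (hf.mono le_rfl hsub1).slope (convex_ball _ _) ht he hsub2
      fun z hz => hball z hz t ht htε
    have has := (ha.mono le_rfl hsub1).slope (convex_ball _ _) ht he hsub2
      fun z hz => hball z hz t ht htε
    have hDs : HolderBdd α (Metric.ball (0 : ℂ) (r' + 2 * ε)) 0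
        (fun z => fderiv ℝ v (z + t • e) Complex.I) G := by
      refine ⟨fun z hz => (norm_apply_unit_le _ Complex.norm_I).trans
        (hD1 _ (hball z hz t ht htε)), fun z hz z' hz' => ?_⟩
      rw [← sub_apply]
      refine (norm_apply_unit_le _ Complex.norm_I).trans ?_
      simpa using hD2 _ (hball z hz t ht htε) _ (hball z' hz' t ht htε)
    have hrhs := hfs.add (HolderBdd.bilin has hDs Metric.isOpen_ball (convex_ball _ _) hα hΛ hG0
      (-ContinuousLinearMap.id ℝ (V →L[ℝ] V)) (M := 1)
      (by rw [norm_neg]; exact ContinuousLinearMap.norm_id_le)) Metric.isOpen_ball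
    have hLle : N + 2 * 6 ^ 0 * 1 * Λ * G ≤ L := by rw [hL]; linarith
    have hrhs' := hrhs.mono hLle subset_rfl
    have h0 : 0 ≤ 2 * 6 ^ 0 * 1 * Λ * G := by positivity
    refine ⟨hder, hest' a _ _ L (fun z hz => (hder z hz).differentiableAt)
      ⟨t⁻¹ * (G + G), fun z hz => ?_⟩ (fun z hz => ?_) hsq
      (fun z hz => ha0.1 z (hsub1 (hsub2 hz)))
      (fun z hz z' hz' => ha0.2 z (hsub1 (hsub2 hz)) z' (hsub1 (hsub2 hz')))
      (fun z hz => (hvs.1 z hz).trans (by rw [hL]; linarith)) hrhs'.1 hrhs'.2⟩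
    · rw [(hder z hz).fderiv, norm_smul, norm_inv, Real.norm_of_nonneg ht.le]
      exact mul_le_mul_of_nonneg_left ((norm_sub_le _ _).trans
        (add_le_add (hD1 _ (hball z hz t ht htε)) (hD1 _ (hsub2 hz)))) (by positivity)
    · rw [(hder z hz).fderiv]
      have e1 := heq z (hsub1 (hsub2 hz))
      have e2 := heq _ (hsub1 (hball z hz t ht htε))
      simp only [smul_apply, sub_apply, map_smul, map_sub, neg_apply, ContinuousLinearMap.id_apply]
      rw [← e1, ← e2]
      module
  have ht : ∀ n : ℕ, 0 < ε / (n + 1) ∧ ε / (n + 1) ≤ ε := fun n =>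
    ⟨by positivity, div_le_self hε0.le (by linarith [(Nat.cast_nonneg n : (0 : ℝ) ≤ n)])⟩
  have ht0 : Filter.Tendsto (fun n : ℕ => ε / ((n : ℝ) + 1)) Filter.atTop
      (nhdsWithin 0 {0}ᶜ) := by
    refine tendsto_nhdsWithin_iff.2 ⟨?_, Filter.Eventually.of_forall fun n => (ht n).1.ne'⟩
    have := (tendsto_one_div_add_atTop_nhds_zero_nat (𝕜 := ℝ)).const_mul ε
    simpa [div_eq_mul_inv] using this
  refine ⟨C' * L, fun z hz => ?_⟩
  obtain ⟨P, hPb, hP⟩ := exists_hasFDerivAt_of_tendsto hα.1 Metric.isOpen_ball (convex_ball _ _)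
    (w := fun (n : ℕ) z => (ε / ((n : ℝ) + 1))⁻¹ • (v (z + (ε / ((n : ℝ) + 1)) • e) - v z))
    (g := fun z => fderiv ℝ v z e)
    (fun n y hy => ((hquot _ (ht n).1 (ht n).2).1 y (hsub3 hy)).differentiableAt)
    (fun n => (hquot _ (ht n).1 (ht n).2).2.1) (fun n => (hquot _ (ht n).1 (ht n).2).2.2)
    (fun y hy => (hasLineDerivAt_iff_tendsto_slope_zero.1
      ((hvG.2.1 y (hsub2 (hsub3 hy))).hasFDerivAt.hasLineDerivAt e)).comp ht0) hz
  exact ⟨hP.differentiableAt, by rwa [hP.fderiv]⟩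

theorem HolderBdd.of_add {X V : Type} [NormedAddCommGroup X] [NormedSpace ℝ X]
    [NormedAddCommGroup V] [NormedSpace ℝ V] {α : ℝ} {U : Set X} {k m : ℕ} {w : X → V} {K : ℝ}
    (h : HolderBdd α U (m + k) w K) (hα : α ∈ Set.Ioo (0 : ℝ) 1) (hU : Convex ℝ U) (hK : 0 ≤ K) :
    HolderBdd α U m w (3 ^ k * K) := by
  induction k generalizing K with
  | zero => simpa using h
  | succ k ih =>
    have := ih (HolderBdd.of_succ (k := m + k) h hα hU hK) (by positivity)
    rwa [pow_succ, mul_assoc]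

theorem fderiv_eq_smulRightL_add {V : Type*} [NormedAddCommGroup V] [NormedSpace ℝ V]
    (T : ℂ →L[ℝ] V) :
    T = ContinuousLinearMap.smulRightL ℝ ℂ V Complex.reCLM (T 1) +
      ContinuousLinearMap.smulRightL ℝ ℂ V Complex.imCLM (T Complex.I) := by
  ext z
  have : z = z.re • (1 : ℂ) + z.im • Complex.I := by
    apply Complex.ext <;> simp
  conv_lhs => rw [this, map_add, map_smul, map_smul]
  simp

/-- Interior Schauder estimate of every order for linear Cauchy–Riemann type equations. -/
theorem exists_schauder_estimate {V : Type} [NormedAddCommGroup V] [NormedSpace ℝ V]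
    [FiniteDimensional ℝ V] {α : ℝ} (hα : α ∈ Set.Ioo (0 : ℝ) 1) (k : ℕ) {Λ r' r : ℝ} (hΛ : 0 ≤ Λ)
    (hr : r' < r) :
    ∃ C, 0 ≤ C ∧ ∀ (a : ℂ → V →L[ℝ] V) (v f : ℂ → V) (N : ℝ), 0 ≤ N →
      (∀ z ∈ Metric.ball (0 : ℂ) r, DifferentiableAt ℝ v z) →
      (∃ B, ∀ z ∈ Metric.ball (0 : ℂ) r, ‖fderiv ℝ v z‖ ≤ B) →
      (∀ z ∈ Metric.ball (0 : ℂ) r, fderiv ℝ v z 1 + a z (fderiv ℝ v z Complex.I) = f z) →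
      (∀ z x, a z (a z x) = -x) →
      HolderBdd α (Metric.ball (0 : ℂ) r) k a Λ → (∀ z ∈ Metric.ball (0 : ℂ) r, ‖v z‖ ≤ N) →
      HolderBdd α (Metric.ball (0 : ℂ) r) k f N →
      HolderBdd α (Metric.ball (0 : ℂ) r') (k + 1) v (C * N) := by
  induction k generalizing Λ r' r with
  | zero =>
    obtain ⟨C, hC, h⟩ := exists_linear_estimate (V := V) hα hΛ hr
    refine ⟨C + 1, by positivity, fun a v f N hN hv hvb heq hsq ha hvN hf => ?_⟩
    obtain ⟨h1, h2⟩ := h a v f N hv hvb heq hsq ha.1 ha.2 hvN hf.1 hf.2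
    have hsub : Metric.ball (0 : ℂ) r' ⊆ Metric.ball 0 r := Metric.ball_subset_ball hr.le
    have hCN : 0 ≤ C * N := by positivity
    refine ⟨fun z hz => (hvN z (hsub hz)).trans (by linarith), fun z hz => hv z (hsub hz),
      fun z hz => (h1 z hz).trans (by linarith), fun z hz z' hz' => (h2 z hz z' hz').trans ?_⟩
    exact mul_le_mul_of_nonneg_right (by linarith) (by positivity)
  | succ k ih =>
    set ra := (2 * r' + r) / 3 with hra
    set rb := (r' + 2 * r) / 3 with hrb
    obtain ⟨C₁, hC₁, h₁⟩ := ih (Λ := 3 * Λ) (r' := rb) (r := r) (by positivity) (by linarith)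
    obtain ⟨C₂, hC₂, h₂⟩ := ih (Λ := 3 * Λ) (r' := r') (r := ra) (by positivity) (by linarith)
    set M := 1 + 2 * 6 ^ k * Λ * C₁ * 3 + C₁ * 3 with hM
    have hM0 : 0 ≤ M := by positivity
    refine ⟨3 * C₁ + 2 * C₂ * M, by positivity, fun a v f N hN hv hvb heq hsq ha hvN hf => ?_⟩
    have hba : Metric.ball (0 : ℂ) ra ⊆ Metric.ball 0 r := Metric.ball_subset_ball (by linarith)
    have hbab : Metric.ball (0 : ℂ) ra ⊆ Metric.ball 0 rb := Metric.ball_subset_ball (by linarith)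
    have hbb : Metric.ball (0 : ℂ) r' ⊆ Metric.ball 0 ra := Metric.ball_subset_ball (by linarith)
    have ha' := (ha.of_succ hα (convex_ball _ _) hΛ)
    have hv1 := h₁ a v f (3 * N) (by positivity) hv hvb heq hsq ha'
      (fun z hz => (hvN z hz).trans (by linarith)) (hf.of_succ hα (convex_ball _ _) hN)
    have h3k : (1 : ℝ) ≤ 3 ^ k := one_le_pow₀ (by norm_num)
    rw [add_comm k 1] at ha hf
    have hdir : ∀ e : ℂ, ‖e‖ = 1 → ∃ B, ∀ z ∈ Metric.ball (0 : ℂ) ra,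
        DifferentiableAt ℝ (fun z => fderiv ℝ v z e) z ∧
        ‖fderiv ℝ (fun z => fderiv ℝ v z e) z‖ ≤ B := fun e he =>
      exists_bound_fderiv_fderiv_apply hα (Λ := 3 ^ k * Λ) (N := 3 ^ k * N) (by positivity)
        (by positivity) (by linarith) hv hvb heq hsq (ha.of_add hα (convex_ball _ _) hΛ)
        (fun z hz => (hvN z hz).trans (le_mul_of_one_le_left hN h3k))
        (hf.of_add hα (convex_ball _ _) hN) he
    rw [add_comm 1 k] at ha hf
    obtain ⟨B₁, hB₁⟩ := hdir 1 norm_one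
    obtain ⟨B₂, hB₂⟩ := hdir Complex.I Complex.norm_I
    have hD2 : ∀ z ∈ Metric.ball (0 : ℂ) ra, DifferentiableAt ℝ (fderiv ℝ v) z := fun z hz => by
      have hfun : fderiv ℝ v = fun z =>
          ContinuousLinearMap.smulRightL ℝ ℂ V Complex.reCLM (fderiv ℝ v z 1) +
          ContinuousLinearMap.smulRightL ℝ ℂ V Complex.imCLM (fderiv ℝ v z Complex.I) :=
        funext fun z => fderiv_eq_smulRightL_add _
      rw [hfun]
      exact ((ContinuousLinearMap.differentiableAt _).comp z (hB₁ z hz).1).add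
        ((ContinuousLinearMap.differentiableAt _).comp z (hB₂ z hz).1)
    have hsymm : ∀ z ∈ Metric.ball (0 : ℂ) ra, ∀ x y : ℂ,
        fderiv ℝ (fderiv ℝ v) z x y = fderiv ℝ (fderiv ℝ v) z y x := fun z hz x y =>
      second_derivative_symmetric_of_eventually (f := v)
        (Filter.eventually_of_mem (Metric.isOpen_ball.mem_nhds (hba hz))
          fun y hy => (hv y hy).hasFDerivAt) (hD2 z hz).hasFDerivAt x y
    have hwd : ∀ e : ℂ, ∀ z ∈ Metric.ball (0 : ℂ) ra, HasFDerivAt (fun z => fderiv ℝ v z e)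
        ((ContinuousLinearMap.apply ℝ V e).comp (fderiv ℝ (fderiv ℝ v) z)) z := fun e z hz =>
      (ContinuousLinearMap.apply ℝ V e).hasFDerivAt.comp z (hD2 z hz).hasFDerivAt
    have happ : ∀ {W : Type} [NormedAddCommGroup W] [NormedSpace ℝ W] (e : ℂ), ‖e‖ = 1 →
        ‖ContinuousLinearMap.apply ℝ W e‖ ≤ 1 := fun e he =>
      ContinuousLinearMap.opNorm_le_bound _ zero_le_one fun T => by
        rw [one_mul]; exact norm_apply_unit_le T he
    have hw : ∀ e : ℂ, ‖e‖ = 1 → HolderBdd α (Metric.ball (0 : ℂ) r') (k + 1)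
        (fun z => fderiv ℝ v z e) (C₂ * (M * N)) := by
      intro e he
      obtain ⟨B, hB⟩ := hdir e he
      have hrhs := ((hf.2.2.mono le_rfl hba).clm_comp Metric.isOpen_ball _ (happ e he)).add
        (HolderBdd.bilin ((ha.2.2.mono le_rfl hba).clm_comp Metric.isOpen_ball _ (happ e he))
          ((hv1.2.2.mono le_rfl hbab).clm_comp Metric.isOpen_ball _ (happ Complex.I Complex.norm_I))
          Metric.isOpen_ball (convex_ball _ _) hα (by positivity) (by positivity)
          (-ContinuousLinearMap.id ℝ (V →L[ℝ] V)) (M := 1)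
          (by rw [norm_neg]; exact ContinuousLinearMap.norm_id_le)) Metric.isOpen_ball
      refine h₂ a _ _ (M * N) (by positivity) (fun z hz => (hB z hz).1) ⟨B, fun z hz => (hB z hz).2⟩
        (fun z hz => ?_) hsq (ha'.mono le_rfl hba) (fun z hz => ?_)
        (hrhs.mono ?_ subset_rfl)
      · have hev : (fun z => fderiv ℝ v z 1 + a z (fderiv ℝ v z Complex.I)) =ᶠ[nhds z] f :=
          Filter.eventuallyEq_of_mem (Metric.isOpen_ball.mem_nhds (hba hz)) heq
        have hl := (hwd 1 z hz).add
          ((ha.2.1 z (hba hz)).hasFDerivAt.clm_apply (hwd Complex.I z hz))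
        have h := congrArg (fun T : ℂ →L[ℝ] V => T e)
          ((hl.congr_of_eventuallyEq hev.symm).fderiv)
        simp only [add_apply, ContinuousLinearMap.comp_apply, ContinuousLinearMap.apply_apply,
          ContinuousLinearMap.flip_apply] at h
        rw [(hwd e z hz).fderiv]
        simp only [ContinuousLinearMap.comp_apply, ContinuousLinearMap.apply_apply, neg_apply,
          ContinuousLinearMap.id_apply]
        rw [h, hsymm z hz e, hsymm z hz e]
        abel
      · refine (norm_apply_unit_le _ he).trans ((hv1.2.2.bound z (hbab hz)).trans ?_)
        have : 0 ≤ (1 + 2 * 6 ^ k * Λ * C₁ * 3) * N := by positivity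
        rw [hM, add_mul]; linarith
      · have : 0 ≤ C₁ * 3 * N := by positivity
        rw [hM]; linarith
    have hone : ∀ c : ℂ →L[ℝ] ℝ, ‖c‖ = 1 → ‖ContinuousLinearMap.smulRightL ℝ ℂ V c‖ ≤ 1 :=
      fun c hc => ContinuousLinearMap.opNorm_le_bound _ zero_le_one fun x => by
        exact (ContinuousLinearMap.norm_smulRight_apply c x).le.trans (by rw [hc])
    have hfin := (((hw 1 norm_one).clm_comp Metric.isOpen_ball _
      (hone Complex.reCLM Complex.reCLM_norm)).add
      ((hw Complex.I Complex.norm_I).clm_comp Metric.isOpen_ball _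
      (hone Complex.imCLM Complex.imCLM_norm)) Metric.isOpen_ball).congr (w' := fderiv ℝ v)
      Metric.isOpen_ball fun z _ => fderiv_eq_smulRightL_add _
    have hpos : 0 ≤ C₂ * M * N := by positivity
    have hpos' : 0 ≤ C₁ * N := by positivity
    exact ⟨fun z hz => (hv1.bound z (hbab (hbb hz))).trans (by linarith),
      fun z hz => hv z (hba (hbb hz)), hfin.mono (by linarith) subset_rfl⟩

theorem HolderBdd.comp_add_right {X V : Type} [NormedAddCommGroup X] [NormedSpace ℝ X]
    [NormedAddCommGroup V] [NormedSpace ℝ V] {α : ℝ} {k : ℕ} {w : X → V} {K : ℝ}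
    (h : HolderBdd α Set.univ k w K) (c : X) :
    HolderBdd α Set.univ k (fun x => w (x + c)) K := by
  induction k generalizing V with
  | zero =>
    refine ⟨fun x _ => h.1 _ trivial, fun x _ y _ => ?_⟩
    simpa using h.2 (x + c) trivial (y + c) trivial
  | succ k ih =>
    refine ⟨fun x _ => h.1 _ trivial, fun x _ => ?_, (ih h.2.2).congr isOpen_univ fun x _ =>
      fderiv_comp_add_right c⟩
    exact (hasFDerivAt_comp_add_right c).2 (h.2.1 (x + c) trivial).hasFDerivAt |>.differentiableAt

/-- Interior estimates of every order for `J`-holomorphic discs of small diameter. -/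
theorem exists_interior_estimate {V : Type} [NormedAddCommGroup V] [NormedSpace ℝ V]
    [FiniteDimensional ℝ V] {α : ℝ} (hα : α ∈ Set.Ioo (0 : ℝ) 1) {k : ℕ} {J : V → V →L[ℝ] V} {M : ℝ}
    (hM : 0 ≤ M) (hJ : HolderBdd α Set.univ k J M) (hsq : ∀ x v, J x (J x v) = -v) {j : ℕ}
    (hj : j ≤ k + 1) {r : ℝ} (hr0 : 0 < r) (hr : r < 1) :
    ∃ δ > 0, ∃ C, 0 ≤ C ∧ ∀ (u : ℂ → V) (ω : ℝ),
      (∀ z ∈ Metric.ball (0 : ℂ) 1, DifferentiableAt ℝ u z) →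
      (∀ z ∈ Metric.ball (0 : ℂ) 1, fderiv ℝ u z 1 + J (u z) (fderiv ℝ u z Complex.I) = 0) →
      (∀ z ∈ Metric.ball (0 : ℂ) 1, ∀ z' ∈ Metric.ball (0 : ℂ) 1, ‖u z - u z'‖ ≤ ω) → ω < δ →
      HolderBdd α (Metric.ball (0 : ℂ) r) j (fun z => u z - u 0) (C * ω) ∧
      ∀ z ∈ Metric.ball (0 : ℂ) r, ‖fderiv ℝ u z‖ ≤ C * ω := by
  have h01 : (0 : ℂ) ∈ Metric.ball (0 : ℂ) 1 := Metric.mem_ball_self one_pos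
  induction j generalizing r with
  | zero =>
    have hJ0 : HolderBdd α Set.univ 0 J (3 ^ k * M) :=
      HolderBdd.of_add (m := 0) (k := k) (by rwa [zero_add]) hα convex_univ hM
    obtain ⟨δ, hδ, C, hC, h⟩ := exists_interior_gradient_estimate hα
      (fun x => hJ0.1 x trivial) (by positivity) (fun x x' => hJ0.2 x trivial x' trivial) hsq hr0 hr
    refine ⟨δ, hδ, 2 + C, by positivity, fun u ω hu heq hω hωδ => ?_⟩
    have hω0 : 0 ≤ ω := (norm_nonneg _).trans (hω 0 h01 0 h01)
    have hsub : Metric.ball (0 : ℂ) r ⊆ Metric.ball 0 1 := Metric.ball_subset_ball hr.le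
    have hD := h u ω hu heq hω hωδ
    refine ⟨(HolderBdd.of_lipschitz hα (K := ω) (L := C * ω) (fun z hz => hω z (hsub hz) 0 h01)
      fun z hz z' hz' => ?_).mono ?_ subset_rfl, fun z hz => (hD z hz).trans ?_⟩
    · rw [sub_sub_sub_cancel_right]
      exact (convex_ball (0 : ℂ) r).norm_image_sub_le_of_norm_fderiv_le
        (fun y hy => hu y (hsub hy)) hD hz' hz
    · rw [abs_of_nonneg (by positivity)]; linarith
    · linarith
  | succ j ih =>
    set r₁ := (r + 1) / 2 with hr₁
    obtain ⟨δ, hδ, C, hC, h⟩ := ih (by omega) (r := r₁) (by positivity) (by linarith)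
    have hJj : HolderBdd α Set.univ j J (3 ^ (k - j) * M) :=
      HolderBdd.of_add (m := j) (k := k - j) (by rwa [Nat.add_sub_cancel' (by omega)]) hα
        convex_univ hM
    obtain ⟨A, hA, hcomp⟩ := HolderBdd.exists_comp (X := ℂ) (U := Metric.ball (0 : ℂ) r₁) hα j
      (3 ^ (k - j) * M) (C * δ) (by positivity) (by positivity)
    obtain ⟨C', hC', hest⟩ := exists_schauder_estimate (V := V) hα j hA
      (show r < r₁ by linarith)
    refine ⟨δ, hδ, C + C', by positivity, fun u ω hu heq hω hωδ => ?_⟩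
    have hω0 : 0 ≤ ω := (norm_nonneg _).trans (hω 0 h01 0 h01)
    have hsub : Metric.ball (0 : ℂ) r₁ ⊆ Metric.ball 0 1 := Metric.ball_subset_ball (by linarith)
    have hsub' : Metric.ball (0 : ℂ) r ⊆ Metric.ball 0 r₁ := Metric.ball_subset_ball (by linarith)
    obtain ⟨h1, h2⟩ := h u ω hu heq hω hωδ
    have hCω : C * ω ≤ C * δ := mul_le_mul_of_nonneg_left hωδ.le hC
    have hfd : ∀ z, fderiv ℝ (fun z => u z - u 0) z = fderiv ℝ u z := fun z => fderiv_sub_const _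
    have ha := hcomp (fun x => J (x + u 0)) (fun z => u z - u 0) Metric.isOpen_ball
      (convex_ball _ _) (hJj.comp_add_right (u 0)) (h1.mono hCω subset_rfl)
      (fun z hz => (hu z (hsub hz)).sub_const _)
      (fun z hz => by rw [hfd]; exact (h2 z hz).trans hCω)
    simp only [sub_add_cancel] at ha
    have h0 : 0 ≤ C * ω := by positivity
    have h0' : 0 ≤ C' * ω := by positivity
    refine ⟨(hest (fun z => J (u z)) (fun z => u z - u 0)
      (fun z => (0 : (V →L[ℝ] V) →L[ℝ] V) (J (u z))) ω hω0
      (fun z hz => (hu z (hsub hz)).sub_const _) ⟨C * ω, fun z hz => by rw [hfd]; exact h2 z hz⟩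
      (fun z hz => by rw [hfd]; exact heq z (hsub hz)) (fun z => hsq (u z)) ha
      (fun z hz => hω z (hsub hz) 0 h01)
      ((ha.clm_comp Metric.isOpen_ball (0 : (V →L[ℝ] V) →L[ℝ] V) (M := 0) (by simp)).mono
        (by linarith) subset_rfl)).mono (by linarith) subset_rfl,
      fun z hz => (h2 z (hsub' hz)).trans (by linarith)⟩

/-- local chart version of the interior Gromov–Schwarz estimate
(Theorem 2.2).  The `C^{k,α}` regularity of the almost complex structure `J`
is encoded by bounds `MJ` (on all derivatives up to order `k`) and `HJ`
(an `α`-Hölder constant for the `k`-th derivative). -/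
theorem interior_gromov_schwarz (n k : ℕ) (hn : 1 ≤ n)
    (α : ℝ) (hα : α ∈ Set.Ioo (0 : ℝ) 1) (μ : ℝ) (hμ : μ ∈ Set.Ioo (0 : ℝ) 1)
    (J : (Fin n → ℂ) → ((Fin n → ℂ) →L[ℝ] (Fin n → ℂ)))
    (hJreg : ContDiff ℝ (k : ℕ∞) J) (MJ HJ : ℝ)
    (hJbd : ∀ x, ∑ j ∈ Finset.range (k + 1), ‖iteratedFDeriv ℝ j J x‖ ≤ MJ)
    (hJhol : ∀ x x',
      ‖iteratedFDeriv ℝ k J x - iteratedFDeriv ℝ k J x'‖ ≤ HJ * ‖x - x'‖ ^ α)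
    (hJsq : ∀ x v, J x (J x v) = -v) :
    ∃ δ > 0, ∃ C > 0, ∀ u : ℂ → (Fin n → ℂ),
      ContinuousOn u (Metric.closedBall (0 : ℂ) 1) →
      (∀ z ∈ Metric.ball (0 : ℂ) 1, DifferentiableAt ℝ u z) →
      (∀ z ∈ Metric.ball (0 : ℂ) 1,
        fderiv ℝ u z 1 + J (u z) (fderiv ℝ u z Complex.I) = 0) →
      Metric.diam (u '' Metric.ball (0 : ℂ) 1) < δ →
      ContDiffOn ℝ ((k : ℕ∞) + 1) u (Metric.closedBall (0 : ℂ) μ) ∧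
      (∀ z ∈ Metric.closedBall (0 : ℂ) μ,
        ∑ j ∈ Finset.Icc 1 (k + 1), ‖iteratedFDeriv ℝ j u z‖ ≤
          C * Metric.diam (u '' Metric.ball (0 : ℂ) 1)) ∧
      (∀ z ∈ Metric.closedBall (0 : ℂ) μ, ∀ z' ∈ Metric.closedBall (0 : ℂ) μ,
        ‖iteratedFDeriv ℝ (k + 1) u z - iteratedFDeriv ℝ (k + 1) u z'‖ ≤
          C * Metric.diam (u '' Metric.ball (0 : ℂ) 1) * ‖z - z'‖ ^ α) := by
  obtain ⟨hμ0, hμ1⟩ := hμ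
  set M := max MJ (max HJ 0) with hM
  have hM0 : 0 ≤ M := (le_max_right _ _).trans (le_max_right _ _)
  have hJ : HolderBdd α Set.univ k J M := by
    refine HolderBdd.of_contDiff hJreg (fun j hj x => ?_) fun x y => (hJhol x y).trans ?_
    · refine (le_trans ?_ (hJbd x)).trans (le_max_left _ _)
      exact Finset.single_le_sum (f := fun j => ‖iteratedFDeriv ℝ j J x‖)
        (fun _ _ => norm_nonneg _) (Finset.mem_range.2 (Nat.lt_succ_of_le hj))
    · exact mul_le_mul_of_nonneg_right ((le_max_left _ _).trans (le_max_right _ _)) (by positivity)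
  obtain ⟨δ, hδ, C, hC, hest⟩ := exists_interior_estimate hα hM0 hJ hJsq (le_refl (k + 1))
    (r := (1 + μ) / 2) (by linarith) (by linarith)
  refine ⟨δ, hδ, (k + 1) * C + 1, by positivity, fun u hc hu heq hdiam => ?_⟩
  set ω := Metric.diam (u '' Metric.ball (0 : ℂ) 1) with hω
  have hω0 : 0 ≤ ω := Metric.diam_nonneg
  have hbdd : Bornology.IsBounded (u '' Metric.ball (0 : ℂ) 1) :=
    (((isCompact_closedBall (0 : ℂ) 1).image_of_continuousOn hc).isBounded).subset
      (Set.image_mono Metric.ball_subset_closedBall)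
  have hfin := (hest u ω hu heq (fun z hz z' hz' => by
    rw [← dist_eq_norm]
    exact Metric.dist_le_diam_of_mem hbdd (Set.mem_image_of_mem u hz)
      (Set.mem_image_of_mem u hz')) hdiam).1
  have hsub : Metric.closedBall (0 : ℂ) μ ⊆ Metric.ball 0 ((1 + μ) / 2) :=
    Metric.closedBall_subset_ball (by linarith)
  have hcd := (hfin.contDiffOn Metric.isOpen_ball hα.1).mono hsub
  have hD := hfin.2.2
  rw [show fderiv ℝ (fun z => u z - u 0) = fderiv ℝ u from funext fun z => fderiv_sub_const _] at hD
  refine ⟨?_, fun z hz => ?_, fun z hz z' hz' => ?_⟩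
  · have := hcd.add (contDiffOn_const (c := u 0))
    simp only [sub_add_cancel] at this
    exact_mod_cast this
  · have hle : ∀ j ∈ Finset.Icc 1 (k + 1), ‖iteratedFDeriv ℝ j u z‖ ≤ C * ω := fun j hj => by
      rw [Finset.mem_Icc] at hj
      obtain ⟨i, rfl⟩ : ∃ i, j = i + 1 := ⟨j - 1, by omega⟩
      rw [← norm_iteratedFDeriv_fderiv]
      exact hD.norm_iteratedFDeriv_le (by omega) z (hsub hz)
    have := Finset.sum_le_card_nsmul _ _ _ hle
    rw [Nat.card_Icc, Nat.add_sub_cancel, nsmul_eq_mul] at this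
    push_cast at this
    linarith
  · rw [HolderBdd.norm_iteratedFDeriv_succ_sub]
    refine (hD.norm_iteratedFDeriv_sub_le z (hsub hz) z' (hsub hz')).trans ?_
    have hk : 0 ≤ (k : ℝ) * C * ω := by positivity
    exact mul_le_mul_of_nonneg_right (by linarith) (by positivity)
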